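/- Let Ω ⊂ ℝⁿ be a smooth bounded domain with n ≥ 2, let p > 1 and r ∈ [1,∞), and assume n = p(1+r). Then there exist positive constants C₃ and C₄ depending only on n and p such that for every v ∈ C^∞ on the closure of Ω with v = 0 on ∂Ω, setting I_p := ( ∫_{Ω ∩ {|∇v|>0}} |H_v|^{pr} |∇v|^p dx )^{1/p} and p' := p/(p−1), if I_p > 0 then ∫_Ω exp( (|v| / (C₃ I_p))^{p'} ) dx ≤ C₄ |Ω|. -/

import Mathlib

open MeasureTheory Filter Bornology
open scoped ENNReal Topology

/-- Divergence of a vector field on `ℝⁿ = EuclideanSpace ℝ (Fin n)`. -/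
noncomputable def divg {n : ℕ} (V : EuclideanSpace ℝ (Fin n) → EuclideanSpace ℝ (Fin n))
    (x : EuclideanSpace ℝ (Fin n)) : ℝ :=
  ∑ i, fderiv ℝ V x (EuclideanSpace.single i 1) i

/-- `H_v(x) = -(1/(n-1)) div(∇v/|∇v|)(x)`, the mean curvature of the level set of `|v|`
through `x` (at points where `∇v(x) ≠ 0`). -/
noncomputable def meanCurv {n : ℕ} (v : EuclideanSpace ℝ (Fin n) → ℝ)
    (x : EuclideanSpace ℝ (Fin n)) : ℝ :=
  -(1 / ((n : ℝ) - 1)) * divg (fun y => ‖gradient v y‖⁻¹ • gradient v y) x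

theorem hasFDerivAt_euclidean_apply {n : ℕ}
    {V : EuclideanSpace ℝ (Fin n) → EuclideanSpace ℝ (Fin n)} {x : EuclideanSpace ℝ (Fin n)}
    (hV : DifferentiableAt ℝ V x) (i : Fin n) :
    HasFDerivAt (fun y => V y i) ((EuclideanSpace.proj i).comp (fderiv ℝ V x)) x :=
  (EuclideanSpace.proj (𝕜 := ℝ) i).hasFDerivAt.comp x hV.hasFDerivAt

theorem integral_mul_divg {n : ℕ} {f : EuclideanSpace ℝ (Fin n) → ℝ}
    {V : EuclideanSpace ℝ (Fin n) → EuclideanSpace ℝ (Fin n)}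
    (hf : ContDiff ℝ 1 f) (hfc : HasCompactSupport f) (hV : ContDiff ℝ 1 V) :
    ∫ x, f x * divg V x = - ∫ x, fderiv ℝ f x (V x) := by
  have hVd : Differentiable ℝ V := hV.differentiable one_ne_zero
  have hfd : Differentiable ℝ f := hf.differentiable one_ne_zero
  have hVi : ∀ i, ContDiff ℝ 1 (fun y => V y i) := fun i =>
    (EuclideanSpace.proj (𝕜 := ℝ) i).contDiff.comp hV
  have hcf' : ∀ w, Continuous fun x => fderiv ℝ f x w := fun w =>
    (hf.continuous_fderiv one_ne_zero).clm_apply continuous_const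
  have hcV' : ∀ i w, Continuous fun x => fderiv ℝ (fun y => V y i) x w := fun i w =>
    ((hVi i).continuous_fderiv one_ne_zero).clm_apply continuous_const
  have hsf' : ∀ w, HasCompactSupport fun x => fderiv ℝ f x w := fun w =>
    hfc.fderiv_apply ℝ w
  have e1 : ∀ i x, fderiv ℝ V x (EuclideanSpace.single i 1) i =
      fderiv ℝ (fun y => V y i) x (EuclideanSpace.single i 1) := fun i x => by
    rw [(hasFDerivAt_euclidean_apply (hVd x) i).fderiv]; rfl
  have I1 : ∀ i, Integrable fun x => f x * fderiv ℝ (fun y => V y i) x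
      (EuclideanSpace.single i 1) := fun i =>
    (hf.continuous.mul (hcV' i _)).integrable_of_hasCompactSupport hfc.mul_right
  have I2 : ∀ i, Integrable fun x => fderiv ℝ f x (EuclideanSpace.single i 1) * V x i := fun i =>
    ((hcf' _).mul (hVi i).continuous).integrable_of_hasCompactSupport (hsf' _).mul_right
  have I3 : ∀ i, Integrable fun x => f x * V x i := fun i =>
    (hf.continuous.mul (hVi i).continuous).integrable_of_hasCompactSupport hfc.mul_right
  have e2 : ∀ x, fderiv ℝ f x (V x) = ∑ i, fderiv ℝ f x (EuclideanSpace.single i 1) * V x i := by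
    intro x
    conv_lhs => rw [← (EuclideanSpace.basisFun (Fin n) ℝ).sum_repr (V x)]
    simp [mul_comm]
  simp only [divg, e1, Finset.mul_sum, e2]
  rw [integral_finsetSum _ fun i _ => I1 i, integral_finsetSum _ fun i _ => I2 i,
    ← Finset.sum_neg_distrib]
  exact Finset.sum_congr rfl fun i _ => integral_mul_fderiv_eq_neg_fderiv_mul_of_integrable
    (I2 i) (I1 i) (I3 i) (fun x _ => hfd x) (fun x _ => (hVi i).differentiable one_ne_zero x)

theorem norm_gradient_eq {n : ℕ} (u : EuclideanSpace ℝ (Fin n) → ℝ)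
    (x : EuclideanSpace ℝ (Fin n)) : ‖gradient u x‖ = ‖fderiv ℝ u x‖ := by
  simp [gradient]

theorem ContDiff.gradient' {n : ℕ} {u : EuclideanSpace ℝ (Fin n) → ℝ}
    (hu : ContDiff ℝ (⊤ : ℕ∞) u) : ContDiff ℝ (⊤ : ℕ∞) (gradient u) :=
  (InnerProductSpace.toDual ℝ (EuclideanSpace ℝ (Fin n))).symm.contDiff.comp
    (hu.fderiv_right (by simp))

theorem inner_fderiv_gradient_comm {n : ℕ} {u : EuclideanSpace ℝ (Fin n) → ℝ}
    (hu : ContDiff ℝ (⊤ : ℕ∞) u) (x w z : EuclideanSpace ℝ (Fin n)) :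
    inner ℝ (fderiv ℝ (gradient u) x w) z = inner ℝ (fderiv ℝ (gradient u) x z) w := by
  have h1 : DifferentiableAt ℝ (fderiv ℝ u) x :=
    ((hu.fderiv_right (m := 1) (by norm_cast)).differentiable one_ne_zero) x
  have h2 : DifferentiableAt ℝ (gradient u) x := hu.gradient'.differentiable (by simp) x
  have key : ∀ w z, inner ℝ (fderiv ℝ (gradient u) x w) z = fderiv ℝ (fderiv ℝ u) x w z := by
    intro w z
    have e1 := (h2.hasFDerivAt.inner ℝ (hasFDerivAt_const z x)).fderiv
    have e2 := (h1.hasFDerivAt.clm_apply (hasFDerivAt_const z x)).fderiv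
    have : (fun y => inner ℝ (gradient u y) z) = fun y => fderiv ℝ u y z :=
      funext fun y => inner_gradient_left
    rw [this, e2] at e1
    simpa using (congrArg (fun L => L w) e1).symm
  rw [key, key]
  exact (hu.contDiffAt (x := x)).isSymmSndFDerivAt (by simp; norm_cast) w z

/-- The regularised unit normal `∇u / √(δ² + |∇u|²)`. -/
noncomputable def regNormal {n : ℕ} (u : EuclideanSpace ℝ (Fin n) → ℝ) (δ : ℝ)
    (x : EuclideanSpace ℝ (Fin n)) : EuclideanSpace ℝ (Fin n) :=
  (√(δ ^ 2 + ‖gradient u x‖ ^ 2))⁻¹ • gradient u x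

theorem hasFDerivAt_regNorm {n : ℕ} {u : EuclideanSpace ℝ (Fin n) → ℝ}
    (hu : ContDiff ℝ (⊤ : ℕ∞) u) {δ : ℝ} {x : EuclideanSpace ℝ (Fin n)}
    (h : δ ^ 2 + ‖gradient u x‖ ^ 2 ≠ 0) :
    HasFDerivAt (fun y => √(δ ^ 2 + ‖gradient u y‖ ^ 2))
      ((√(δ ^ 2 + ‖gradient u x‖ ^ 2))⁻¹ •
        (innerSL ℝ (gradient u x)).comp (fderiv ℝ (gradient u) x)) x := by
  have hN : HasFDerivAt (gradient u) (fderiv ℝ (gradient u) x) x :=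
    (hu.gradient'.differentiable (by simp) x).hasFDerivAt
  refine ((hN.norm_sq.const_add (δ ^ 2)).sqrt h).congr_fderiv ?_
  ext w
  simp
  ring

theorem hasFDerivAt_regNormal {n : ℕ} {u : EuclideanSpace ℝ (Fin n) → ℝ}
    (hu : ContDiff ℝ (⊤ : ℕ∞) u) {δ : ℝ} {x : EuclideanSpace ℝ (Fin n)}
    (h : δ ^ 2 + ‖gradient u x‖ ^ 2 ≠ 0) :
    ∃ L : EuclideanSpace ℝ (Fin n) →L[ℝ] EuclideanSpace ℝ (Fin n), HasFDerivAt (regNormal u δ) L x ∧ ∀ w,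
      L w = (√(δ ^ 2 + ‖gradient u x‖ ^ 2))⁻¹ • fderiv ℝ (gradient u) x w -
        ((√(δ ^ 2 + ‖gradient u x‖ ^ 2))⁻¹ ^ 3 *
          inner ℝ (gradient u x) (fderiv ℝ (gradient u) x w)) • gradient u x := by
  have hN : HasFDerivAt (gradient u) (fderiv ℝ (gradient u) x) x :=
    (hu.gradient'.differentiable (by simp) x).hasFDerivAt
  have hpos : 0 < δ ^ 2 + ‖gradient u x‖ ^ 2 := lt_of_le_of_ne (by positivity) h.symm
  have hg : √(δ ^ 2 + ‖gradient u x‖ ^ 2) ≠ 0 := (Real.sqrt_pos.2 hpos).ne'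
  refine ⟨_, ((hasDerivAt_inv hg).comp_hasFDerivAt x (hasFDerivAt_regNorm hu h)).smul hN, ?_⟩
  intro w
  simp [sub_eq_add_neg, smul_smul]
  congr 1
  field_simp

/-- The explicit expression of the divergence of the (regularised) unit normal. -/
noncomputable def regDiv {n : ℕ} (u : EuclideanSpace ℝ (Fin n) → ℝ) (δ : ℝ)
    (x : EuclideanSpace ℝ (Fin n)) : ℝ :=
  ∑ i, ((√(δ ^ 2 + ‖gradient u x‖ ^ 2))⁻¹ *
      fderiv ℝ (gradient u) x (EuclideanSpace.single i 1) i -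
    (√(δ ^ 2 + ‖gradient u x‖ ^ 2))⁻¹ ^ 3 *
      inner ℝ (gradient u x) (fderiv ℝ (gradient u) x (EuclideanSpace.single i 1)) *
        gradient u x i)

theorem divg_regNormal {n : ℕ} {u : EuclideanSpace ℝ (Fin n) → ℝ}
    (hu : ContDiff ℝ (⊤ : ℕ∞) u) {δ : ℝ} {x : EuclideanSpace ℝ (Fin n)}
    (h : δ ^ 2 + ‖gradient u x‖ ^ 2 ≠ 0) : divg (regNormal u δ) x = regDiv u δ x := by
  obtain ⟨L, hL, hw⟩ := hasFDerivAt_regNormal hu h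
  simp [divg, regDiv, hL.fderiv, hw]

theorem regNormal_zero {n : ℕ} (u : EuclideanSpace ℝ (Fin n) → ℝ) :
    regNormal u 0 = fun y => ‖gradient u y‖⁻¹ • gradient u y := by
  ext y; simp [regNormal]

theorem norm_gradient_mul_abs_regDiv_le {n : ℕ} (u : EuclideanSpace ℝ (Fin n) → ℝ) (δ : ℝ)
    (x : EuclideanSpace ℝ (Fin n)) :
    ‖gradient u x‖ * |regDiv u δ x| ≤ 2 * n * ‖fderiv ℝ (gradient u) x‖ := by
  set g := √(δ ^ 2 + ‖gradient u x‖ ^ 2) with hg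
  have hNg : ‖gradient u x‖ ≤ g := Real.le_sqrt_of_sq_le (by nlinarith [sq_nonneg δ])
  set N := ‖gradient u x‖ with hN
  have hg0 : 0 ≤ g := Real.sqrt_nonneg _
  have hN0 : 0 ≤ N := norm_nonneg _
  have hr : N * g⁻¹ ≤ 1 := by
    rw [← div_eq_mul_inv]; exact div_le_one_of_le₀ hNg hg0
  have hr0 : 0 ≤ N * g⁻¹ := by positivity
  set D := ‖fderiv ℝ (gradient u) x‖ with hD
  have hDi : ∀ i : Fin n, ‖fderiv ℝ (gradient u) x (EuclideanSpace.single i 1)‖ ≤ D := fun i => by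
    simpa using (fderiv ℝ (gradient u) x).le_opNorm (EuclideanSpace.single i 1)
  have hD0 : 0 ≤ D := norm_nonneg _
  rw [regDiv, ← abs_of_nonneg hN0, ← abs_mul, Finset.mul_sum]
  calc _ ≤ ∑ i : Fin n, 2 * D := by
        refine (Finset.abs_sum_le_sum_abs _ _).trans (Finset.sum_le_sum fun i _ => ?_)
        have h1 : |fderiv ℝ (gradient u) x (EuclideanSpace.single i 1) i| ≤ D :=
          (PiLp.norm_apply_le _ i).trans (hDi i)
        have h2 : |inner ℝ (gradient u x)
            (fderiv ℝ (gradient u) x (EuclideanSpace.single i 1))| ≤ N * D :=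
          (abs_real_inner_le_norm _ _).trans (by gcongr; exact hDi i)
        have h3 : |gradient u x i| ≤ N := by
          rw [← Real.norm_eq_abs]; exact PiLp.norm_apply_le _ i
        rw [mul_sub, two_mul]
        refine (abs_sub _ _).trans (add_le_add ?_ ?_)
        · rw [← mul_assoc, abs_mul, abs_of_nonneg hr0]
          exact (mul_le_mul hr h1 (abs_nonneg _) zero_le_one).trans (one_mul D).le
        · have : N * (g⁻¹ ^ 3 * inner ℝ (gradient u x)
              (fderiv ℝ (gradient u) x (EuclideanSpace.single i 1)) * gradient u x i) =
              (N * g⁻¹) * g⁻¹ ^ 2 * (inner ℝ (gradient u x)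
              (fderiv ℝ (gradient u) x (EuclideanSpace.single i 1)) * gradient u x i) := by ring
          rw [this, abs_mul, abs_of_nonneg (by positivity), abs_mul]
          calc _ ≤ (N * g⁻¹) * g⁻¹ ^ 2 * (N * D * N) := by gcongr
            _ = (N * g⁻¹) ^ 3 * D := by ring
            _ ≤ 1 * D := by gcongr; exact pow_le_one₀ hr0 hr
            _ = D := one_mul D
    _ = _ := by simp; ring

theorem contDiff_regNorm {n : ℕ} {u : EuclideanSpace ℝ (Fin n) → ℝ}
    (hu : ContDiff ℝ (⊤ : ℕ∞) u) {δ : ℝ} (hδ : 0 < δ) :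
    ContDiff ℝ 1 (fun y => √(δ ^ 2 + ‖gradient u y‖ ^ 2)) := by
  have h1 : ContDiff ℝ 1 (gradient u) := hu.gradient'.of_le (by norm_cast)
  exact (contDiff_const.add (h1.norm_sq ℝ)).sqrt fun x => by positivity

theorem contDiff_regNormal {n : ℕ} {u : EuclideanSpace ℝ (Fin n) → ℝ}
    (hu : ContDiff ℝ (⊤ : ℕ∞) u) {δ : ℝ} (hδ : 0 < δ) : ContDiff ℝ 1 (regNormal u δ) := by
  have h1 : ContDiff ℝ 1 (gradient u) := hu.gradient'.of_le (by norm_cast)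
  exact ((contDiff_regNorm hu hδ).inv fun x => (Real.sqrt_pos.2 (by positivity)).ne').smul h1

theorem HasCompactSupport.gradient' {n : ℕ} {u : EuclideanSpace ℝ (Fin n) → ℝ}
    (hc : HasCompactSupport u) : HasCompactSupport (gradient u) :=
  (hc.fderiv ℝ).comp_left (g := (InnerProductSpace.toDual ℝ (EuclideanSpace ℝ (Fin n))).symm)
    (map_zero _)

theorem continuous_divg {n : ℕ} {X : EuclideanSpace ℝ (Fin n) → EuclideanSpace ℝ (Fin n)}
    (hX : ContDiff ℝ 1 X) : Continuous (divg X) := by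
  have := hX.continuous_fderiv one_ne_zero
  unfold divg
  refine continuous_finsetSum _ fun i _ => ?_
  exact (EuclideanSpace.proj (𝕜 := ℝ) i).continuous.comp (this.clm_apply continuous_const)

theorem first_variation_reg {n : ℕ} {u : EuclideanSpace ℝ (Fin n) → ℝ}
    (hu : ContDiff ℝ (⊤ : ℕ∞) u) (hc : HasCompactSupport u)
    {X : EuclideanSpace ℝ (Fin n) → EuclideanSpace ℝ (Fin n)} (hX : ContDiff ℝ 1 X)
    {δ : ℝ} (hδ : 0 < δ) :
    ∫ x, ((√(δ ^ 2 + ‖gradient u x‖ ^ 2) - δ) * divg X x -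
      (√(δ ^ 2 + ‖gradient u x‖ ^ 2))⁻¹ *
        inner ℝ (fderiv ℝ X x (gradient u x)) (gradient u x)) =
      ∫ x, inner ℝ (X x) (gradient u x) * regDiv u δ x := by
  have hN : ContDiff ℝ 1 (gradient u) := hu.gradient'.of_le (by norm_cast)
  have hne : ∀ x, δ ^ 2 + ‖gradient u x‖ ^ 2 ≠ 0 := fun x => by positivity
  have hgc := hc.gradient'
  have hNd : Differentiable ℝ (gradient u) := hN.differentiable one_ne_zero
  have hXd : Differentiable ℝ X := hX.differentiable one_ne_zero
  have hcX := hX.continuous_fderiv one_ne_zero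
  have hcN := hN.continuous_fderiv one_ne_zero
  have hgcont := (contDiff_regNorm hu hδ).continuous
  have hginv : Continuous fun x => (√(δ ^ 2 + ‖gradient u x‖ ^ 2))⁻¹ :=
    hgcont.inv₀ fun x => (Real.sqrt_pos.2 (by positivity)).ne'
  have hA : HasCompactSupport fun x => inner ℝ (X x) (gradient u x) := by
    refine hgc.mono fun x hx => ?_
    simp only [Function.mem_support] at hx ⊢
    rintro h
    exact hx (by rw [h, inner_zero_right])
  have hB : HasCompactSupport fun x => √(δ ^ 2 + ‖gradient u x‖ ^ 2) - δ := by
    refine hgc.mono fun x hx => ?_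
    simp only [Function.mem_support] at hx ⊢
    rintro h
    exact hx (by simp [h, Real.sqrt_sq hδ.le])
  have eA := integral_mul_divg (hX.inner ℝ hN) hA (contDiff_regNormal hu hδ)
  have eB := integral_mul_divg ((contDiff_regNorm hu hδ).sub contDiff_const) hB hX
  have dA : ∀ x, fderiv ℝ (fun x => inner ℝ (X x) (gradient u x)) x (regNormal u δ x) =
      (√(δ ^ 2 + ‖gradient u x‖ ^ 2))⁻¹ *
        inner ℝ (fderiv ℝ X x (gradient u x)) (gradient u x) +
      fderiv ℝ (fun x => √(δ ^ 2 + ‖gradient u x‖ ^ 2) - δ) x (X x) := by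
    intro x
    rw [((hasFDerivAt_regNorm hu (hne x)).sub_const δ).fderiv, fderiv_inner_apply ℝ (hXd x) (hNd x)]
    have := inner_fderiv_gradient_comm hu x (gradient u x) (X x)
    simp only [regNormal, map_smul, inner_smul_left, inner_smul_right, smul_apply,
      ContinuousLinearMap.comp_apply, innerSL_apply_apply, smul_eq_mul, conj_trivial]
    rw [real_inner_comm, this, real_inner_comm (gradient u x) (fderiv ℝ (gradient u) x (X x))]
    ring
  simp only [divg_regNormal hu (hne _), dA] at eA
  have I1 : Integrable fun x => (√(δ ^ 2 + ‖gradient u x‖ ^ 2))⁻¹ *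
        inner ℝ (fderiv ℝ X x (gradient u x)) (gradient u x) := by
    refine Continuous.integrable_of_hasCompactSupport
      (hginv.mul ((hcX.clm_apply hN.continuous).inner hN.continuous)) ?_
    refine hgc.mono fun x hx => ?_
    simp only [Function.mem_support] at hx ⊢
    rintro h
    exact hx (by simp [h])
  have I2 : Integrable fun x => fderiv ℝ (fun x => √(δ ^ 2 + ‖gradient u x‖ ^ 2) - δ) x (X x) :=
    ((((contDiff_regNorm hu hδ).sub contDiff_const).continuous_fderiv one_ne_zero).clm_apply
      hX.continuous).integrable_of_hasCompactSupport ((hB.fderiv ℝ).mono fun x hx => by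
        simp only [Function.mem_support] at hx ⊢
        rintro h
        exact hx (by simp [h]))
  have I3 : Integrable fun x => (√(δ ^ 2 + ‖gradient u x‖ ^ 2) - δ) * divg X x :=
    ((hgcont.sub continuous_const).mul (continuous_divg hX)).integrable_of_hasCompactSupport
      hB.mul_right
  rw [integral_sub I3 I1, eA, integral_add I1 I2, eB]
  ring

theorem tendsto_regNorm {a : ℝ} (ha : 0 ≤ a) :
    Tendsto (fun k : ℕ => √((1 / ((k : ℝ) + 1)) ^ 2 + a ^ 2)) atTop (𝓝 a) := by
  have h := tendsto_one_div_add_atTop_nhds_zero_nat (𝕜 := ℝ)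
  have := ((h.pow 2).add_const (a ^ 2)).sqrt
  simpa [Real.sqrt_sq ha] using this

/-- First variation formula, integrated over the level sets of `u`. -/
theorem first_variation {n : ℕ} {u : EuclideanSpace ℝ (Fin n) → ℝ}
    (hu : ContDiff ℝ (⊤ : ℕ∞) u) (hc : HasCompactSupport u)
    {X : EuclideanSpace ℝ (Fin n) → EuclideanSpace ℝ (Fin n)} (hX : ContDiff ℝ 1 X) :
    ∫ x, (‖gradient u x‖ * divg X x -
      ‖gradient u x‖⁻¹ * inner ℝ (fderiv ℝ X x (gradient u x)) (gradient u x)) =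
      ∫ x, inner ℝ (X x) (gradient u x) * regDiv u 0 x := by
  have hN : ContDiff ℝ 1 (gradient u) := hu.gradient'.of_le (by norm_cast)
  have hgc := hc.gradient'
  have hcX := hX.continuous_fderiv one_ne_zero
  have hcN := hN.continuous_fderiv one_ne_zero
  have hNc := hN.continuous
  have hδ : ∀ k : ℕ, 0 < 1 / ((k : ℝ) + 1) := fun k => by positivity
  have hgcont := fun k => (contDiff_regNorm hu (hδ k)).continuous
  have hginv : ∀ k : ℕ, Continuous fun x => (√((1 / ((k : ℝ) + 1)) ^ 2 + ‖gradient u x‖ ^ 2))⁻¹ :=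
    fun k => (hgcont k).inv₀ fun x => (Real.sqrt_pos.2 (by positivity)).ne'
  have hL : Tendsto (fun k : ℕ => ∫ x, ((√((1 / ((k : ℝ) + 1)) ^ 2 + ‖gradient u x‖ ^ 2) -
      1 / ((k : ℝ) + 1)) * divg X x - (√((1 / ((k : ℝ) + 1)) ^ 2 + ‖gradient u x‖ ^ 2))⁻¹ *
        inner ℝ (fderiv ℝ X x (gradient u x)) (gradient u x))) atTop
      (𝓝 (∫ x, (‖gradient u x‖ * divg X x -
      ‖gradient u x‖⁻¹ * inner ℝ (fderiv ℝ X x (gradient u x)) (gradient u x)))) := by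
    refine tendsto_integral_of_dominated_convergence
      (fun x => ‖gradient u x‖ * |divg X x| + ‖fderiv ℝ X x‖ * ‖gradient u x‖) ?_ ?_ ?_ ?_
    · exact fun k => ((((hgcont k).sub continuous_const).mul (continuous_divg hX)).sub
        ((hginv k).mul ((hcX.clm_apply hNc).inner hNc))).aestronglyMeasurable
    · refine Continuous.integrable_of_hasCompactSupport
        ((hNc.norm.mul (continuous_divg hX).abs).add (hcX.norm.mul hNc.norm)) ?_
      refine hgc.mono fun x hx => ?_
      simp only [Function.mem_support] at hx ⊢
      rintro h
      exact hx (by simp [h])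
    · refine fun k => ae_of_all _ fun x => ?_
      set N := gradient u x
      set δ := 1 / ((k : ℝ) + 1)
      have hδ0 : 0 < δ := hδ k
      have hg1 : ‖N‖ ≤ √(δ ^ 2 + ‖N‖ ^ 2) := Real.le_sqrt_of_sq_le (by nlinarith)
      have hg2 : √(δ ^ 2 + ‖N‖ ^ 2) ≤ δ + ‖N‖ :=
        Real.sqrt_le_iff.2 ⟨by positivity, by nlinarith [norm_nonneg N]⟩
      have hg3 : δ ≤ √(δ ^ 2 + ‖N‖ ^ 2) := Real.le_sqrt_of_sq_le (by nlinarith [sq_nonneg ‖N‖])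
      refine (norm_sub_le _ _).trans (add_le_add ?_ ?_)
      · rw [norm_mul, Real.norm_eq_abs, Real.norm_eq_abs]
        gcongr
        rw [abs_of_nonneg (by linarith)]; linarith
      · have hgp : 0 < √(δ ^ 2 + ‖N‖ ^ 2) := by linarith
        rw [norm_mul, norm_inv, Real.norm_eq_abs, abs_of_pos hgp, inv_mul_le_iff₀ hgp]
        calc _ ≤ ‖fderiv ℝ X x N‖ * ‖N‖ := norm_inner_le_norm _ _
          _ ≤ (‖fderiv ℝ X x‖ * ‖N‖) * √(δ ^ 2 + ‖N‖ ^ 2) := by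
            gcongr; exact ContinuousLinearMap.le_opNorm _ _
          _ = _ := by ring
    · refine ae_of_all _ fun x => ?_
      have h0 := tendsto_regNorm (norm_nonneg (gradient u x))
      have h1 := tendsto_one_div_add_atTop_nhds_zero_nat (𝕜 := ℝ)
      have h2 := (h0.sub h1).mul_const (divg X x)
      rw [sub_zero] at h2
      refine h2.sub ?_
      by_cases hz : gradient u x = 0
      · simp [hz]
      · exact (h0.inv₀ (norm_ne_zero_iff.2 hz)).mul_const _
  have hR : Tendsto (fun k : ℕ => ∫ x, inner ℝ (X x) (gradient u x) *
      regDiv u (1 / ((k : ℝ) + 1)) x) atTop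
      (𝓝 (∫ x, inner ℝ (X x) (gradient u x) * regDiv u 0 x)) := by
    have hei : ∀ (i : Fin n), Continuous fun x =>
        fderiv ℝ (gradient u) x (EuclideanSpace.single i 1) := fun i =>
      hcN.clm_apply continuous_const
    have hpr : ∀ i : Fin n, Continuous fun y : EuclideanSpace ℝ (Fin n) => y i := fun i =>
      (EuclideanSpace.proj (𝕜 := ℝ) i).continuous
    refine tendsto_integral_of_dominated_convergence
      (fun x => ‖X x‖ * (2 * n * ‖fderiv ℝ (gradient u) x‖)) ?_ ?_ ?_ ?_
    · refine fun k => ((hX.continuous.inner hNc).mul ?_).aestronglyMeasurable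
      unfold regDiv
      refine continuous_finsetSum _ fun i _ => ?_
      exact ((hginv k).mul ((hpr i).comp (hei i))).sub
        ((((hginv k).pow 3).mul (hNc.inner (hei i))).mul ((hpr i).comp hNc))
    · refine Continuous.integrable_of_hasCompactSupport
        (hX.continuous.norm.mul (continuous_const.mul hcN.norm)) ?_
      refine (hgc.fderiv ℝ).mono fun x hx => ?_
      simp only [Function.mem_support] at hx ⊢
      rintro h
      exact hx (by simp [h])
    · refine fun k => ae_of_all _ fun x => ?_
      rw [norm_mul, Real.norm_eq_abs (regDiv _ _ _)]
      calc _ ≤ ‖X x‖ * ‖gradient u x‖ * |regDiv u (1 / ((k : ℝ) + 1)) x| := by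
            gcongr; exact norm_inner_le_norm _ _
        _ = ‖X x‖ * (‖gradient u x‖ * |regDiv u (1 / ((k : ℝ) + 1)) x|) := by ring
        _ ≤ _ := mul_le_mul_of_nonneg_left (norm_gradient_mul_abs_regDiv_le _ _ _) (norm_nonneg _)
    · refine ae_of_all _ fun x => ?_
      by_cases hz : gradient u x = 0
      · simp [hz]
      refine Tendsto.const_mul _ ?_
      have h0 := (tendsto_regNorm (norm_nonneg (gradient u x))).inv₀ (norm_ne_zero_iff.2 hz)
      have : regDiv u 0 x = ∑ i, (‖gradient u x‖⁻¹ *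
          fderiv ℝ (gradient u) x (EuclideanSpace.single i 1) i - ‖gradient u x‖⁻¹ ^ 3 *
          inner ℝ (gradient u x) (fderiv ℝ (gradient u) x (EuclideanSpace.single i 1)) *
          gradient u x i) := by simp [regDiv]
      rw [this]
      unfold regDiv
      exact tendsto_finsetSum _ fun i _ => (h0.mul_const _).sub
        (((h0.pow 3).mul_const _).mul_const _)
  refine tendsto_nhds_unique hL ?_
  simp only [first_variation_reg hu hc hX (hδ _)]
  exact hR

theorem hasFDerivAt_radialField {n : ℕ} (x₀ : EuclideanSpace ℝ (Fin n)) {s : ℝ} (hs : 0 < s)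
    (a : ℝ) (x : EuclideanSpace ℝ (Fin n)) :
    ∃ L : EuclideanSpace ℝ (Fin n) →L[ℝ] EuclideanSpace ℝ (Fin n),
      HasFDerivAt (fun y => (s ^ 2 + ‖y - x₀‖ ^ 2) ^ (-a) • (y - x₀)) L x ∧
      ∀ w, L w = (s ^ 2 + ‖x - x₀‖ ^ 2) ^ (-a) • w -
        (2 * a * (s ^ 2 + ‖x - x₀‖ ^ 2) ^ (-a - 1) * inner ℝ (x - x₀) w) • (x - x₀) := by
  have h1 : HasFDerivAt (fun y => y - x₀) (ContinuousLinearMap.id ℝ _) x :=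
    (hasFDerivAt_id x).sub_const x₀
  have hq : s ^ 2 + ‖x - x₀‖ ^ 2 ≠ 0 := by positivity
  refine ⟨_, ((h1.norm_sq.const_add (s ^ 2)).rpow_const (p := -a) (Or.inl hq)).smul h1,
    fun w => ?_⟩
  simp [inner_sub_left]
  module

theorem contDiff_radialField {n : ℕ} (x₀ : EuclideanSpace ℝ (Fin n)) {s : ℝ} (hs : 0 < s)
    (a : ℝ) : ContDiff ℝ 1 (fun y => (s ^ 2 + ‖y - x₀‖ ^ 2) ^ (-a) • (y - x₀)) := by
  have h1 : ContDiff ℝ 1 (fun y : EuclideanSpace ℝ (Fin n) => y - x₀) :=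
    contDiff_id.sub contDiff_const
  exact ((contDiff_const.add (h1.norm_sq ℝ)).rpow_const_of_ne fun x => by positivity).smul h1

theorem measurable_regDiv {n : ℕ} {u : EuclideanSpace ℝ (Fin n) → ℝ}
    (hu : ContDiff ℝ (⊤ : ℕ∞) u) (δ : ℝ) : Measurable (regDiv u δ) := by
  have hN : ContDiff ℝ 1 (gradient u) := hu.gradient'.of_le (by norm_cast)
  have hei : ∀ (i : Fin n), Continuous fun x =>
      fderiv ℝ (gradient u) x (EuclideanSpace.single i 1) := fun i =>
    (hN.continuous_fderiv one_ne_zero).clm_apply continuous_const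
  have hpr : ∀ i : Fin n, Continuous fun y : EuclideanSpace ℝ (Fin n) => y i := fun i =>
    (EuclideanSpace.proj (𝕜 := ℝ) i).continuous
  have hg : Measurable fun x => (√(δ ^ 2 + ‖gradient u x‖ ^ 2))⁻¹ :=
    ((continuous_const.add (hN.continuous.norm.pow 2)).sqrt).measurable.inv
  unfold regDiv
  refine Finset.measurable_fun_sum _ fun i _ => ?_
  exact (hg.mul ((hpr i).comp (hei i)).measurable).sub
    (((hg.pow_const 3).mul (hN.continuous.inner (hei i)).measurable).mul
      ((hpr i).comp hN.continuous).measurable)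

theorem integral_radial_le {n : ℕ} {u : EuclideanSpace ℝ (Fin n) → ℝ}
    (hu : ContDiff ℝ (⊤ : ℕ∞) u) (hc : HasCompactSupport u)
    (x₀ : EuclideanSpace ℝ (Fin n)) {s : ℝ} (hs : 0 < s) {a : ℝ} (ha : (n : ℝ) = 2 * a + 1)
    (ha0 : 0 ≤ a) :
    Integrable (fun x => ‖gradient u x‖ *
      (2 * a * s ^ 2 * (s ^ 2 + ‖x - x₀‖ ^ 2) ^ (-a - 1))) ∧
    Integrable (fun x => ‖x - x₀‖ * (s ^ 2 + ‖x - x₀‖ ^ 2) ^ (-a) *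
      (‖gradient u x‖ * |regDiv u 0 x|)) ∧
    ∫ x, ‖gradient u x‖ * (2 * a * s ^ 2 * (s ^ 2 + ‖x - x₀‖ ^ 2) ^ (-a - 1)) ≤
      ∫ x, ‖x - x₀‖ * (s ^ 2 + ‖x - x₀‖ ^ 2) ^ (-a) * (‖gradient u x‖ * |regDiv u 0 x|) := by
  have hN : ContDiff ℝ 1 (gradient u) := hu.gradient'.of_le (by norm_cast)
  have hNc := hN.continuous
  have hcN := hN.continuous_fderiv one_ne_zero
  have hgc := hc.gradient'
  set X : EuclideanSpace ℝ (Fin n) → EuclideanSpace ℝ (Fin n) :=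
    fun y => (s ^ 2 + ‖y - x₀‖ ^ 2) ^ (-a) • (y - x₀) with hXdef
  have hX : ContDiff ℝ 1 X := contDiff_radialField x₀ hs a
  have hcX := hX.continuous_fderiv one_ne_zero
  have hq : ∀ x : EuclideanSpace ℝ (Fin n), 0 < s ^ 2 + ‖x - x₀‖ ^ 2 := fun x => by positivity
  have hqc : Continuous fun x : EuclideanSpace ℝ (Fin n) => s ^ 2 + ‖x - x₀‖ ^ 2 := by fun_prop
  have hqp : ∀ b : ℝ, Continuous fun x : EuclideanSpace ℝ (Fin n) =>
      (s ^ 2 + ‖x - x₀‖ ^ 2) ^ b := fun b => hqc.rpow_const fun x => Or.inl (hq x).ne'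
  have hDX : ∀ x w, fderiv ℝ X x w = (s ^ 2 + ‖x - x₀‖ ^ 2) ^ (-a) • w -
        (2 * a * (s ^ 2 + ‖x - x₀‖ ^ 2) ^ (-a - 1) * inner ℝ (x - x₀) w) • (x - x₀) := by
    intro x w
    obtain ⟨L, hL, hw⟩ := hasFDerivAt_radialField x₀ hs a x
    rw [hL.fderiv, hw]
  have hdiv : ∀ x, divg X x = n * (s ^ 2 + ‖x - x₀‖ ^ 2) ^ (-a) -
      2 * a * (s ^ 2 + ‖x - x₀‖ ^ 2) ^ (-a - 1) * ‖x - x₀‖ ^ 2 := by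
    intro x
    have h2 : ‖x - x₀‖ ^ 2 = ∑ i, (x - x₀) i * (x - x₀) i := by
      rw [EuclideanSpace.norm_sq_eq]
      exact Finset.sum_congr rfl fun i _ => by rw [Real.norm_eq_abs, sq_abs, sq]
    unfold divg
    simp only [hDX]
    generalize (s ^ 2 + ‖x - x₀‖ ^ 2) ^ (-a) = A
    generalize (s ^ 2 + ‖x - x₀‖ ^ 2) ^ (-a - 1) = B
    rw [h2, Finset.mul_sum]
    simp only [PiLp.sub_apply, PiLp.smul_apply, Finset.sum_sub_distrib, smul_eq_mul]
    congr 1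
    · simp
    · refine Finset.sum_congr rfl fun i _ => ?_
      rw [EuclideanSpace.inner_single_right]
      simp
      ring
  have I1 : Integrable (fun x => ‖gradient u x‖ *
      (2 * a * s ^ 2 * (s ^ 2 + ‖x - x₀‖ ^ 2) ^ (-a - 1))) :=
    (hNc.norm.mul (continuous_const.mul (hqp _))).integrable_of_hasCompactSupport hgc.norm.mul_right
  have hsupp : ∀ f : EuclideanSpace ℝ (Fin n) → ℝ, (∀ x, gradient u x = 0 → f x = 0) →
      HasCompactSupport f := fun f hf => hgc.mono fun x hx => by
    simp only [Function.mem_support] at hx ⊢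
    exact fun h => hx (hf x h)
  have I2 : Integrable (fun x => ‖x - x₀‖ * (s ^ 2 + ‖x - x₀‖ ^ 2) ^ (-a) *
      (‖gradient u x‖ * |regDiv u 0 x|)) := by
    have hk : Continuous fun x => ‖x - x₀‖ * (s ^ 2 + ‖x - x₀‖ ^ 2) ^ (-a) :=
      (by fun_prop : Continuous fun x => ‖x - x₀‖).mul (hqp _)
    refine Integrable.mono' (g := fun x => ‖x - x₀‖ * (s ^ 2 + ‖x - x₀‖ ^ 2) ^ (-a) *
      (2 * n * ‖fderiv ℝ (gradient u) x‖)) ?_ ?_ ?_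
    · refine (hk.mul (continuous_const.mul hcN.norm)).integrable_of_hasCompactSupport ?_
      refine (hgc.fderiv ℝ).mono fun x hx => ?_
      simp only [Function.mem_support] at hx ⊢
      rintro h
      exact hx (by simp [h])
    · exact (hk.measurable.mul (hNc.norm.measurable.mul
        (measurable_regDiv hu 0).abs)).aestronglyMeasurable
    · refine ae_of_all _ fun x => ?_
      have := (hq x).le
      rw [Real.norm_of_nonneg (by positivity)]
      exact mul_le_mul_of_nonneg_left (norm_gradient_mul_abs_regDiv_le u 0 x) (by positivity)
  refine ⟨I1, I2, ?_⟩
  have I3 : Integrable fun x => ‖gradient u x‖ * divg X x -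
      ‖gradient u x‖⁻¹ * inner ℝ (fderiv ℝ X x (gradient u x)) (gradient u x) := by
    refine Integrable.mono' (g := fun x => ‖gradient u x‖ * |divg X x| +
      ‖fderiv ℝ X x‖ * ‖gradient u x‖) ?_ ?_ ?_
    · exact ((hNc.norm.mul (continuous_divg hX).abs).add
        (hcX.norm.mul hNc.norm)).integrable_of_hasCompactSupport
          (hsupp _ fun x h => by simp [h])
    · exact ((hNc.norm.mul (continuous_divg hX)).measurable.sub (hNc.norm.measurable.inv.mul
        ((hcX.clm_apply hNc).inner hNc).measurable)).aestronglyMeasurable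
    · refine ae_of_all _ fun x => (norm_sub_le _ _).trans (add_le_add ?_ ?_)
      · simp
      · rw [norm_mul, norm_inv, norm_norm]
        by_cases hz : gradient u x = 0
        · simp [hz]
        have hp := norm_pos_iff.2 hz
        rw [inv_mul_le_iff₀ hp]
        calc _ ≤ ‖fderiv ℝ X x (gradient u x)‖ * ‖gradient u x‖ := norm_inner_le_norm _ _
          _ ≤ (‖fderiv ℝ X x‖ * ‖gradient u x‖) * ‖gradient u x‖ := by
            gcongr; exact ContinuousLinearMap.le_opNorm _ _
          _ = _ := by ring
  have I4 : Integrable fun x => inner ℝ (X x) (gradient u x) * regDiv u 0 x := by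
    refine I2.mono' ((hX.continuous.inner hNc).measurable.mul
      (measurable_regDiv hu 0)).aestronglyMeasurable (ae_of_all _ fun x => ?_)
    have := (hq x).le
    rw [norm_mul, Real.norm_eq_abs (regDiv _ _ _), ← mul_assoc]
    gcongr
    refine (norm_inner_le_norm _ _).trans_eq ?_
    simp only [hXdef]
    rw [norm_smul, Real.norm_of_nonneg (by positivity)]; ring
  have hfv := first_variation hu hc hX
  calc _ ≤ ∫ x, (‖gradient u x‖ * divg X x -
      ‖gradient u x‖⁻¹ * inner ℝ (fderiv ℝ X x (gradient u x)) (gradient u x)) := by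
        refine integral_mono I1 I3 fun x => ?_
        by_cases hz : gradient u x = 0
        · simp [hz]
        have hp := norm_pos_iff.2 hz
        simp only [hdiv, hDX, inner_sub_left, inner_smul_left, real_inner_self_eq_norm_sq,
          conj_trivial]
        rw [← inner_sub_left]
        set q := s ^ 2 + ‖x - x₀‖ ^ 2 with hqd
        have hqa : q ^ (-a) = q * q ^ (-a - 1) := by
          have h := Real.rpow_add (hq x) 1 (-a - 1)
          rw [Real.rpow_one] at h
          rw [← h]; congr 1; ring
        have h0 : 0 ≤ ‖gradient u x‖⁻¹ * (2 * a * q ^ (-a - 1) *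
            inner ℝ (x - x₀) (gradient u x) * inner ℝ (x - x₀) (gradient u x)) := by
          have : 0 ≤ q ^ (-a - 1) := Real.rpow_nonneg (hq x).le _
          have h3 := mul_self_nonneg (inner ℝ (x - x₀) (gradient u x))
          rw [mul_assoc]
          positivity
        have h1 : ‖gradient u x‖⁻¹ * (q ^ (-a) * ‖gradient u x‖ ^ 2) =
            q ^ (-a) * ‖gradient u x‖ := by field_simp
        rw [mul_sub, mul_sub, h1, ha, hqa]
        have : s ^ 2 = q - ‖x - x₀‖ ^ 2 := by rw [hqd]; ring
        rw [this]
        nlinarith [h0]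
    _ = ∫ x, inner ℝ (X x) (gradient u x) * regDiv u 0 x := hfv
    _ ≤ _ := by
        refine integral_mono I4 I2 fun x => ?_
        have := (hq x).le
        refine (le_abs_self _).trans ?_
        simp only
        rw [abs_mul, ← mul_assoc]
        gcongr
        refine (abs_real_inner_le_norm _ _).trans_eq ?_
        simp only [hXdef]
        rw [norm_smul, Real.norm_of_nonneg (by positivity)]; ring

theorem le_radial_kernel {m : ℕ} (hm : 2 ≤ m) {s t : ℝ} (hs : 0 < s) (ht : 0 ≤ t) (hts : t ≤ s) :
    (2 ^ m * s ^ m)⁻¹ ≤ 2 * ((m : ℝ) / 2) * s ^ 2 * (s ^ 2 + t ^ 2) ^ (-((m : ℝ) / 2) - 1) := by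
  have hm' : (2 : ℝ) ≤ m := by exact_mod_cast hm
  have hq : 0 < s ^ 2 + t ^ 2 := by positivity
  have hle : s ^ 2 + t ^ 2 ≤ 2 * s ^ 2 := by nlinarith
  have h1 : (2 * s ^ 2) ^ (-((m : ℝ) / 2) - 1) ≤ (s ^ 2 + t ^ 2) ^ (-((m : ℝ) / 2) - 1) :=
    Real.rpow_le_rpow_of_nonpos hq hle (by linarith)
  have h2 : (2 * s ^ 2) ^ (-((m : ℝ) / 2) - 1) =
      2 ^ (-((m : ℝ) / 2) - 1) * (s ^ m)⁻¹ * (s ^ 2)⁻¹ := by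
    rw [Real.mul_rpow (by norm_num) (by positivity), mul_assoc]
    congr 1
    rw [← Real.rpow_natCast s 2, ← Real.rpow_mul hs.le, ← Real.rpow_natCast s m,
      ← Real.rpow_neg hs.le, ← Real.rpow_neg hs.le, ← Real.rpow_add hs]
    congr 1
    push_cast
    ring
  have h3 : (2 ^ m : ℝ)⁻¹ ≤ 2 ^ (-((m : ℝ) / 2) - 1) := by
    rw [← Real.rpow_natCast, ← Real.rpow_neg (by norm_num)]
    exact Real.rpow_le_rpow_of_exponent_le (by norm_num) (by linarith)
  calc (2 ^ m * s ^ m)⁻¹ = 1 * s ^ 2 * ((2 ^ m : ℝ)⁻¹ * (s ^ m)⁻¹ * (s ^ 2)⁻¹) := by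
        field_simp
    _ ≤ 2 * ((m : ℝ) / 2) * s ^ 2 * (2 ^ (-((m : ℝ) / 2) - 1) * (s ^ m)⁻¹ * (s ^ 2)⁻¹) := by
        gcongr
        linarith
    _ ≤ _ := by rw [← h2]; gcongr

theorem radial_kernel_le {m : ℕ} (hm : 1 ≤ m) {s t : ℝ} (hs : 0 < s) :
    t * (s ^ 2 + t ^ 2) ^ (-((m : ℝ) / 2)) ≤ (max t s ^ (m - 1))⁻¹ := by
  set M := max t s with hM
  have hMp : 0 < M := lt_max_of_lt_right hs
  have hMt : t ≤ M := le_max_left _ _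
  have hle : M ^ 2 ≤ s ^ 2 + t ^ 2 := by
    rcases max_choice t s with h | h <;> rw [hM, h] <;> nlinarith
  have h1 : (s ^ 2 + t ^ 2) ^ (-((m : ℝ) / 2)) ≤ (M ^ m)⁻¹ := by
    refine (Real.rpow_le_rpow_of_nonpos (by positivity) hle
      (by simp only [Left.neg_nonpos_iff]; positivity)).trans_eq ?_
    rw [← Real.rpow_natCast M 2, ← Real.rpow_mul hMp.le, ← Real.rpow_natCast M m,
      ← Real.rpow_neg hMp.le]
    congr 1
    push_cast
    ring
  calc _ ≤ M * (M ^ m)⁻¹ := by gcongr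
    _ = _ := by
      obtain ⟨k, rfl⟩ := Nat.exists_eq_add_of_le' hm
      simp only [Nat.add_sub_cancel]
      field_simp
      ring

/-- The measure `|∇u| dx`, i.e. the sum over all levels of the surface measures. -/
noncomputable def levelMeasure {n : ℕ} (u : EuclideanSpace ℝ (Fin n) → ℝ) :
    Measure (EuclideanSpace ℝ (Fin n)) :=
  volume.withDensity fun x => ENNReal.ofReal ‖gradient u x‖

/-- The measure `|div (∇u / |∇u|)| |∇u| dx`. -/
noncomputable def curvMeasure {n : ℕ} (u : EuclideanSpace ℝ (Fin n) → ℝ) :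
    Measure (EuclideanSpace ℝ (Fin n)) :=
  volume.withDensity fun x => ENNReal.ofReal (‖gradient u x‖ * |regDiv u 0 x|)

theorem levelMeasure_closedBall_le {m n : ℕ} (hm : 2 ≤ m) (hn : n = m + 1)
    {u : EuclideanSpace ℝ (Fin n) → ℝ}
    (hu : ContDiff ℝ (⊤ : ℕ∞) u) (hc : HasCompactSupport u)
    (x₀ : EuclideanSpace ℝ (Fin n)) {s : ℝ} (hs : 0 < s) :
    levelMeasure u (Metric.closedBall x₀ s) ≤ ENNReal.ofReal (2 ^ m * s ^ m) *
      ∫⁻ x, ENNReal.ofReal ((max (dist x x₀) s ^ (m - 1))⁻¹) ∂(curvMeasure u) := by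
  obtain ⟨I1, I2, hle⟩ := integral_radial_le hu hc x₀ hs (a := (m : ℝ) / 2)
    (by rw [hn]; push_cast; ring) (by positivity)
  have hN : ContDiff ℝ 1 (gradient u) := hu.gradient'.of_le (by norm_cast)
  have hNm : Measurable fun x => ‖gradient u x‖ := hN.continuous.norm.measurable
  have hpos : 0 < 2 ^ m * s ^ m := by positivity
  have hne : ENNReal.ofReal (2 ^ m * s ^ m) ≠ 0 := by simpa using hpos
  rw [mul_comm, ← ENNReal.div_le_iff hne ENNReal.ofReal_ne_top, ENNReal.div_eq_inv_mul,
    ← ENNReal.ofReal_inv_of_pos hpos]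
  have hq : ∀ x : EuclideanSpace ℝ (Fin n), 0 ≤ s ^ 2 + ‖x - x₀‖ ^ 2 := fun x => by positivity
  have hm1 : Measurable fun x : EuclideanSpace ℝ (Fin n) =>
      ENNReal.ofReal ((max (dist x x₀) s ^ (m - 1))⁻¹) := by fun_prop
  calc _ = ∫⁻ x in Metric.closedBall x₀ s, ENNReal.ofReal ((2 ^ m * s ^ m)⁻¹) *
        ENNReal.ofReal ‖gradient u x‖ := by
        rw [levelMeasure, withDensity_apply _ Metric.isClosed_closedBall.measurableSet,
          lintegral_const_mul _ hNm.ennreal_ofReal]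
    _ ≤ ∫⁻ x in Metric.closedBall x₀ s, ENNReal.ofReal (‖gradient u x‖ *
      (2 * ((m : ℝ) / 2) * s ^ 2 * (s ^ 2 + ‖x - x₀‖ ^ 2) ^ (-((m : ℝ) / 2) - 1))) := by
        refine setLIntegral_mono_ae' Metric.isClosed_closedBall.measurableSet
          (ae_of_all _ fun x hx => ?_)
        rw [← ENNReal.ofReal_mul (by positivity), mul_comm]
        refine ENNReal.ofReal_le_ofReal ?_
        gcongr
        rw [mem_closedBall_iff_norm] at hx
        exact le_radial_kernel hm hs (norm_nonneg _) hx
    _ ≤ ∫⁻ x, ENNReal.ofReal (‖gradient u x‖ *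
      (2 * ((m : ℝ) / 2) * s ^ 2 * (s ^ 2 + ‖x - x₀‖ ^ 2) ^ (-((m : ℝ) / 2) - 1))) :=
        setLIntegral_le_lintegral _ _
    _ = ENNReal.ofReal (∫ x, (‖gradient u x‖ *
      (2 * ((m : ℝ) / 2) * s ^ 2 * (s ^ 2 + ‖x - x₀‖ ^ 2) ^ (-((m : ℝ) / 2) - 1)))) := by
        rw [ofReal_integral_eq_lintegral_ofReal I1 (ae_of_all _ fun x => ?_)]
        have := Real.rpow_nonneg (hq x) (-((m : ℝ) / 2) - 1)
        simp only [Pi.zero_apply]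
        positivity
    _ ≤ _ := ENNReal.ofReal_le_ofReal hle
    _ = ∫⁻ x, ENNReal.ofReal (‖x - x₀‖ * (s ^ 2 + ‖x - x₀‖ ^ 2) ^ (-((m : ℝ) / 2)) *
      (‖gradient u x‖ * |regDiv u 0 x|)) := by
        rw [ofReal_integral_eq_lintegral_ofReal I2 (ae_of_all _ fun x => ?_)]
        have := Real.rpow_nonneg (hq x) (-((m : ℝ) / 2))
        simp only [Pi.zero_apply]
        positivity
    _ ≤ ∫⁻ x, ENNReal.ofReal (‖gradient u x‖ * |regDiv u 0 x|) *
        ENNReal.ofReal ((max (dist x x₀) s ^ (m - 1))⁻¹) := by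
        refine lintegral_mono fun x => ?_
        rw [← ENNReal.ofReal_mul (by positivity), mul_comm]
        refine ENNReal.ofReal_le_ofReal ?_
        gcongr
        rw [dist_eq_norm]
        exact radial_kernel_le (by omega) hs
    _ = _ := by
        have hd : Measurable fun x => ENNReal.ofReal (‖gradient u x‖ * |regDiv u 0 x|) :=
          (hNm.mul (measurable_regDiv hu 0).abs).ennreal_ofReal
        exact (lintegral_withDensity_eq_lintegral_mul _ hd hm1).symm

theorem kernel_le_tsum_dyadic {E : Type*} [PseudoMetricSpace E] (k : ℕ) (x₀ x : E) {s : ℝ}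
    (hs : 0 < s) :
    ENNReal.ofReal ((max (dist x x₀) s ^ k)⁻¹) ≤
      ∑' j : ℕ, (Metric.closedBall x₀ (2 ^ j * s)).indicator
        (fun _ => ENNReal.ofReal (2 ^ k * ((2 ^ j * s) ^ k)⁻¹)) x := by
  obtain ⟨j, hj, hj'⟩ : ∃ j : ℕ, dist x x₀ ≤ 2 ^ j * s ∧ 2 ^ j * s ≤ 2 * max (dist x x₀) s := by
    rcases le_or_gt (dist x x₀) s with h | h
    · exact ⟨0, by simpa using h, by linarith [le_max_right (dist x x₀) s]⟩
    · obtain ⟨j, h1, h2⟩ := exists_nat_pow_near ((one_le_div hs).2 h.le) (one_lt_two)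
      refine ⟨j + 1, ?_, ?_⟩
      · rw [div_lt_iff₀ hs] at h2; exact h2.le
      · rw [le_div_iff₀ hs] at h1
        rw [pow_succ]
        linarith [le_max_left (dist x x₀) s]
  refine le_trans ?_ (ENNReal.le_tsum j)
  rw [Set.indicator_of_mem (Metric.mem_closedBall.2 hj)]
  refine ENNReal.ofReal_le_ofReal ?_
  have hM : 0 < max (dist x x₀) s := lt_max_of_lt_right hs
  rw [inv_le_iff_one_le_mul₀ (by positivity)]
  rw [mul_right_comm, ← mul_pow, ← div_eq_mul_inv, one_le_div (by positivity)]
  gcongr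

theorem sum_min_dyadic_le {s ρ : ℝ} (hs : 0 < s) (hρ : 0 < ρ) (N : ℕ) :
    ∑ j ∈ Finset.range N, min (2 ^ j * s / ρ) (ρ / (2 ^ j * s)) ≤ 6 := by
  set T : ℕ → ℝ := fun j => 2 ^ j * s / (2 ^ j * s + ρ) with hT
  have hstep : ∀ j, min (2 ^ j * s / ρ) (ρ / (2 ^ j * s)) ≤ 6 * (T (j + 1) - T j) := by
    intro j
    simp only [hT, pow_succ]
    have hτ : 0 < 2 ^ j * s := by positivity
    rw [mul_right_comm]
    generalize 2 ^ j * s = τ at hτ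
    have hd : τ * 2 / (τ * 2 + ρ) - τ / (τ + ρ) = τ * ρ / ((τ * 2 + ρ) * (τ + ρ)) := by
      field_simp; ring
    rw [hd, ← mul_div_assoc]
    rcases le_total τ ρ with h | h
    · refine (min_le_left _ _).trans ?_
      rw [div_le_div_iff₀ hρ (by positivity)]
      have : (τ * 2 + ρ) * (τ + ρ) ≤ 6 * ρ ^ 2 := by nlinarith
      nlinarith [mul_le_mul_of_nonneg_left this hτ.le]
    · refine (min_le_right _ _).trans ?_
      rw [div_le_div_iff₀ hτ (by positivity)]
      have : (τ * 2 + ρ) * (τ + ρ) ≤ 6 * τ ^ 2 := by nlinarith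
      nlinarith [mul_le_mul_of_nonneg_left this hρ.le]
  calc _ ≤ ∑ j ∈ Finset.range N, 6 * (T (j + 1) - T j) := Finset.sum_le_sum fun j _ => hstep j
    _ = 6 * (T N - T 0) := by rw [← Finset.mul_sum, Finset.sum_range_sub]
    _ ≤ 6 := by
      have h1 : T N ≤ 1 := div_le_one_of_le₀ (by linarith) (by positivity)
      have h0 : 0 ≤ T 0 := by simp only [hT]; positivity
      linarith

section MichaelSimon

variable {E : Type*} [MetricSpace E] [MeasurableSpace E] [BorelSpace E]

theorem exists_radius_of_dense {σ β : Measure E} [IsFiniteMeasure σ] [IsFiniteMeasure β] {m : ℕ}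
    (hm : 2 ≤ m) {x₀ : E}
    (hσβ : ∀ s, 0 < s → σ (Metric.closedBall x₀ s) ≤ ENNReal.ofReal (2 ^ m * s ^ m) *
      ∫⁻ x, ENNReal.ofReal ((max (dist x x₀) s ^ (m - 1))⁻¹) ∂β)
    {c ρ₀ ρ₁ : ℝ} (hc : 0 < c) (hρ₀ : 0 < ρ₀) (hρ₁ : 0 < ρ₁)
    (hP : σ.real Set.univ = c * ρ₁ ^ m)
    (hdense : c * ρ₀ ^ m ≤ σ.real (Metric.closedBall x₀ ρ₀))
    (hβ : 8 * 20 ^ m * (ρ₁ * β.real Set.univ) ≤ σ.real Set.univ) :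
    ∃ τ, 0 < τ ∧ τ ≤ ρ₁ ∧
      σ.real (Metric.closedBall x₀ (5 * τ)) ≤
        8 * 20 ^ m * (ρ₁ * β.real (Metric.closedBall x₀ τ)) := by
  by_contra! hcon
  set P := σ.real Set.univ with hPdef
  set f : ℝ → ℝ := fun τ => σ.real (Metric.closedBall x₀ τ) with hf
  set b : ℝ → ℝ := fun τ => β.real (Metric.closedBall x₀ τ) with hb
  have hfP : ∀ τ, f τ ≤ P := fun τ => measureReal_mono (Set.subset_univ _)
  have hbu : ∀ τ, b τ ≤ β.real Set.univ := fun τ => measureReal_mono (Set.subset_univ _)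
  have hf0 : ∀ τ, 0 ≤ f τ := fun τ => measureReal_nonneg
  have hb0 : ∀ τ, 0 ≤ b τ := fun τ => measureReal_nonneg
  set S : Set ℝ := (fun s => f s / s ^ m) '' Set.Ici ρ₀ with hS
  have hSb : BddAbove S := by
    refine ⟨P / ρ₀ ^ m, ?_⟩
    rintro _ ⟨s, hs, rfl⟩
    have hs' : ρ₀ ≤ s := hs
    have := hfP s
    have := hf0 s
    simp only
    gcongr
  set F := sSup S with hF
  have hFle : ∀ s, ρ₀ ≤ s → f s ≤ F * s ^ m := by
    intro s hs
    have hs0 : 0 < s := hρ₀.trans_le hs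
    rw [← div_le_iff₀ (by positivity)]
    exact le_csSup hSb ⟨s, hs, rfl⟩
  have hcF : c ≤ F := by
    have h1 : f ρ₀ ≤ F * ρ₀ ^ m := hFle _ le_rfl
    have h2 : c * ρ₀ ^ m ≤ F * ρ₀ ^ m := hdense.trans h1
    exact le_of_mul_le_mul_right h2 (by positivity)
  have hFpos : 0 < F := hc.trans_le hcF
  obtain ⟨s, hs, hfs⟩ : ∃ s, ρ₀ ≤ s ∧ F / 2 * s ^ m < f s := by
    obtain ⟨_, ⟨s, hs, rfl⟩, h⟩ := exists_lt_of_lt_csSup (s := S)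
      ⟨_, ρ₀, Set.self_mem_Ici, rfl⟩ (half_lt_self hFpos)
    have hs0 : 0 < s := hρ₀.trans_le hs
    exact ⟨s, hs, (lt_div_iff₀ (by positivity)).1 h⟩
  have hs0 : 0 < s := hρ₀.trans_le hs
  set K : ℝ := 8 * 20 ^ m with hK
  have hKpos : 0 < K := by positivity
  obtain ⟨k, rfl⟩ := Nat.exists_eq_add_of_le' hm
  have key : ∀ τ, s ≤ τ → b τ * (τ ^ (k + 1))⁻¹ ≤
      5 ^ (k + 2) * F / K * min (τ / ρ₁) (ρ₁ / τ) := by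
    intro τ hτ
    have hτ0 : 0 < τ := hs0.trans_le hτ
    have hmain : K * (ρ₁ * b τ) ≤ 5 ^ (k + 2) * F * min (τ ^ (k + 2)) (ρ₁ ^ (k + 2)) := by
      rcases le_total τ ρ₁ with h | h
      · rw [min_eq_left (by gcongr)]
        refine (hcon τ hτ0 h).le.trans ((hFle (5 * τ) (by linarith)).trans_eq ?_)
        rw [mul_pow]; ring
      · rw [min_eq_right (by gcongr)]
        calc K * (ρ₁ * b τ) ≤ K * (ρ₁ * β.real Set.univ) := by
              have := hbu τ
              gcongr
          _ ≤ P := hβ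
          _ = c * ρ₁ ^ (k + 2) := hP
          _ ≤ F * ρ₁ ^ (k + 2) := by gcongr
          _ ≤ 5 ^ (k + 2) * F * ρ₁ ^ (k + 2) := by
            have : (1 : ℝ) ≤ 5 ^ (k + 2) := one_le_pow₀ (by norm_num)
            gcongr
            exact le_mul_of_one_le_left hFpos.le this
    have hmin : min (τ ^ (k + 2)) (ρ₁ ^ (k + 2)) ≤ ρ₁ * τ ^ (k + 1) * min (τ / ρ₁) (ρ₁ / τ) := by
      rw [mul_min_of_nonneg _ _ (by positivity)]
      refine le_min ((min_le_left _ _).trans_eq ?_) ?_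
      · field_simp
        ring
      · rcases le_total τ ρ₁ with h | h
        · refine (min_le_left _ _).trans ?_
          rw [mul_div_assoc', le_div_iff₀ hτ0]
          calc τ ^ (k + 2) * τ = τ * τ ^ (k + 1) * τ := by ring
            _ ≤ ρ₁ * τ ^ (k + 1) * ρ₁ := by gcongr
        · refine (min_le_right _ _).trans ?_
          rw [mul_div_assoc', le_div_iff₀ hτ0]
          calc ρ₁ ^ (k + 2) * τ = ρ₁ ^ k * τ * (ρ₁ * ρ₁) := by ring
            _ ≤ τ ^ k * τ * (ρ₁ * ρ₁) := by gcongr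
            _ = ρ₁ * τ ^ (k + 1) * ρ₁ := by ring
    have h2 : K * (ρ₁ * b τ) ≤
        5 ^ (k + 2) * F * (ρ₁ * τ ^ (k + 1) * min (τ / ρ₁) (ρ₁ / τ)) :=
      hmain.trans (by gcongr)
    rw [← div_eq_mul_inv, div_le_iff₀ (by positivity), div_mul_eq_mul_div, div_mul_eq_mul_div,
      le_div_iff₀ hKpos]
    refine le_of_mul_le_mul_left ?_ hρ₁
    linarith
  have hint : ∫⁻ x, ENNReal.ofReal ((max (dist x x₀) s ^ (k + 1))⁻¹) ∂β ≤
      ENNReal.ofReal (2 ^ (k + 1) * (5 ^ (k + 2) * F / K * 6)) := by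
    calc _ ≤ ∫⁻ x, (∑' j : ℕ, (Metric.closedBall x₀ (2 ^ j * s)).indicator
        (fun _ => ENNReal.ofReal (2 ^ (k + 1) * ((2 ^ j * s) ^ (k + 1))⁻¹)) x) ∂β :=
          lintegral_mono fun x => kernel_le_tsum_dyadic (k + 1) x₀ x hs0
      _ = ∑' j : ℕ, ENNReal.ofReal (2 ^ (k + 1) * ((2 ^ j * s) ^ (k + 1))⁻¹ * b (2 ^ j * s)) := by
          rw [lintegral_tsum fun j => (measurable_const.indicator
            Metric.isClosed_closedBall.measurableSet).aemeasurable]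
          refine tsum_congr fun j => ?_
          rw [lintegral_indicator_const Metric.isClosed_closedBall.measurableSet,
            ← ofReal_measureReal (μ := β), ← ENNReal.ofReal_mul (by positivity)]
      _ ≤ _ := by
          refine ENNReal.tsum_le_of_sum_range_le fun N => ?_
          rw [← ENNReal.ofReal_sum_of_nonneg fun j _ => mul_nonneg (by positivity) (hb0 _)]
          refine ENNReal.ofReal_le_ofReal ?_
          calc _ ≤ ∑ j ∈ Finset.range N, 2 ^ (k + 1) * (5 ^ (k + 2) * F / K *
                min (2 ^ j * s / ρ₁) (ρ₁ / (2 ^ j * s))) := by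
                refine Finset.sum_le_sum fun j _ => ?_
                rw [mul_assoc, mul_comm (((2 : ℝ) ^ j * s) ^ (k + 1))⁻¹]
                refine mul_le_mul_of_nonneg_left ?_ (by positivity)
                have h2j : (1 : ℝ) ≤ 2 ^ j := one_le_pow₀ (by norm_num)
                exact key _ (le_mul_of_one_le_left hs0.le h2j)
            _ = 2 ^ (k + 1) * (5 ^ (k + 2) * F / K * ∑ j ∈ Finset.range N,
                min (2 ^ j * s / ρ₁) (ρ₁ / (2 ^ j * s))) := by
                rw [← Finset.mul_sum, ← Finset.mul_sum]
            _ ≤ _ := by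
                gcongr
                exact sum_min_dyadic_le hs0 hρ₁ N
  have hfin : f s ≤ 2 ^ (k + 2) * s ^ (k + 2) * (2 ^ (k + 1) * (5 ^ (k + 2) * F / K * 6)) := by
    refine (ENNReal.ofReal_le_ofReal_iff (by positivity)).1 ?_
    rw [hf, ofReal_measureReal, ENNReal.ofReal_mul (by positivity)]
    refine (hσβ s hs0).trans ?_
    gcongr
    exact hint
  have h20 : (20 : ℝ) ^ (k + 2) = 2 ^ (k + 2) * 2 ^ (k + 2) * 5 ^ (k + 2) := by
    rw [← mul_pow, ← mul_pow]; norm_num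
  have : 2 ^ (k + 2) * s ^ (k + 2) * (2 ^ (k + 1) * (5 ^ (k + 2) * F / K * 6)) =
      3 / 8 * (F * s ^ (k + 2)) := by
    rw [hK, h20]
    field_simp
    ring
  have h3 : 0 < F * s ^ (k + 2) := by positivity
  linarith

theorem measureReal_dense_le [SecondCountableTopology E] {σ β : Measure E} [IsFiniteMeasure σ]
    [IsFiniteMeasure β] {m : ℕ} (hm : 2 ≤ m)
    (hint : ∀ (x₀ : E) (τ : ℝ), 0 < τ → (interior (Metric.closedBall x₀ τ)).Nonempty)
    (hσβ : ∀ x₀ s, 0 < s → σ (Metric.closedBall x₀ s) ≤ ENNReal.ofReal (2 ^ m * s ^ m) *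
      ∫⁻ x, ENNReal.ofReal ((max (dist x x₀) s ^ (m - 1))⁻¹) ∂β)
    {c ρ₁ : ℝ} (hc : 0 < c) (hρ₁ : 0 < ρ₁) (hP : σ.real Set.univ = c * ρ₁ ^ m) :
    σ.real {x | ∃ ρ, 0 < ρ ∧ c * ρ ^ m ≤ σ.real (Metric.closedBall x ρ)} ≤
      8 * 20 ^ m * (ρ₁ * β.real Set.univ) := by
  rcases lt_or_ge (σ.real Set.univ) (8 * 20 ^ m * (ρ₁ * β.real Set.univ)) with h | h
  · exact (measureReal_mono (Set.subset_univ _)).trans h.le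
  set G := {x | ∃ ρ, 0 < ρ ∧ c * ρ ^ m ≤ σ.real (Metric.closedBall x ρ)} with hG
  have hex : ∀ x : E, ∃ τ, x ∈ G → 0 < τ ∧ τ ≤ ρ₁ ∧
      σ.real (Metric.closedBall x (5 * τ)) ≤
        8 * 20 ^ m * (ρ₁ * β.real (Metric.closedBall x τ)) := by
    intro x
    by_cases hx : x ∈ G
    · obtain ⟨ρ, hρ, hd⟩ := hx
      obtain ⟨τ, h'⟩ := exists_radius_of_dense hm (hσβ x) hc hρ hρ₁ hP hd h
      exact ⟨τ, fun _ => h'⟩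
    · exact ⟨0, fun h => absurd h hx⟩
  choose τ hτ using hex
  obtain ⟨U, hUG, hdisj, hcov⟩ :=
    Vitali.exists_disjoint_subfamily_covering_enlargement_closedBall G (fun x : E => x) τ ρ₁
      (fun x hx => (hτ x hx).2.1) 5 (by norm_num)
  have hUc : U.Countable := hdisj.countable_of_nonempty_interior fun x hx =>
    hint x _ (hτ x (hUG hx)).1
  have hGsub : G ⊆ ⋃ x ∈ U, Metric.closedBall x (5 * τ x) := by
    intro x hx
    obtain ⟨y, hy, hxy⟩ := hcov x hx
    exact Set.mem_biUnion hy (hxy (Metric.mem_closedBall_self (hτ x hx).1.le))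
  have : σ G ≤ ENNReal.ofReal (8 * 20 ^ m * ρ₁) * β Set.univ := by
    calc σ G ≤ σ (⋃ x ∈ U, Metric.closedBall x (5 * τ x)) := measure_mono hGsub
      _ ≤ ∑' x : U, σ (Metric.closedBall x (5 * τ x)) := measure_biUnion_le _ hUc _
      _ ≤ ∑' x : U, ENNReal.ofReal (8 * 20 ^ m * ρ₁) * β (Metric.closedBall x (τ x)) := by
        refine ENNReal.tsum_le_tsum fun x => ?_
        have h1 := (hτ x (hUG x.2)).2.2
        rw [← ofReal_measureReal (μ := σ), ← ofReal_measureReal (μ := β),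
          ← ENNReal.ofReal_mul (by positivity), mul_assoc (8 * 20 ^ m)]
        exact ENNReal.ofReal_le_ofReal h1
      _ = ENNReal.ofReal (8 * 20 ^ m * ρ₁) * β (⋃ x ∈ U, Metric.closedBall x (τ x)) := by
        rw [ENNReal.tsum_mul_left, measure_biUnion hUc hdisj
          fun x _ => Metric.isClosed_closedBall.measurableSet]
      _ ≤ _ := by gcongr; exact Set.subset_univ _
  rw [← mul_assoc, Measure.real, Measure.real, ← ENNReal.toReal_ofReal (r := 8 * 20 ^ m * ρ₁)
    (by positivity), ← ENNReal.toReal_mul]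
  exact ENNReal.toReal_mono (ENNReal.mul_ne_top ENNReal.ofReal_ne_top (measure_ne_top _ _)) this

end MichaelSimon

theorem deriv_smoothTransition_eq_zero {y : ℝ} (hy : y ≤ 0 ∨ 1 ≤ y) :
    deriv Real.smoothTransition y = 0 := by
  rcases hy with hy | hy
  · refine IsLocalMin.deriv_eq_zero (Eventually.of_forall fun z => ?_)
    rw [Real.smoothTransition.zero_of_nonpos hy]
    exact Real.smoothTransition.nonneg z
  · refine IsLocalMax.deriv_eq_zero (Eventually.of_forall fun z => ?_)
    rw [Real.smoothTransition.one_of_one_le hy]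
    exact Real.smoothTransition.le_one z

theorem exists_deriv_smoothTransition_le :
    ∃ D : ℝ, 0 < D ∧ ∀ y, deriv Real.smoothTransition y ≤ D := by
  have hc : Continuous (deriv Real.smoothTransition) :=
    (Real.smoothTransition.contDiff (n := 1)).continuous_deriv le_rfl
  obtain ⟨C, hC⟩ := (isCompact_Icc (a := (0 : ℝ)) (b := 1)).bddAbove_image hc.continuousOn
  refine ⟨max C 1, lt_max_of_lt_right one_pos, fun y => ?_⟩
  by_cases hy : y ∈ Set.Icc (0 : ℝ) 1
  · exact (hC ⟨y, hy, rfl⟩).trans (le_max_left _ _)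
  · rw [deriv_smoothTransition_eq_zero]
    · exact zero_le_one.trans (le_max_right _ _)
    · by_contra! h
      exact hy ⟨h.1.le, h.2.le⟩

/-- The smooth cutoff of `v` on `Ω` between the levels `t` and `t + ε`, extended by zero. -/
noncomputable def levelCut {E : Type*} (Ω : Set E) (v : E → ℝ) (t ε : ℝ) : E → ℝ :=
  Ω.indicator fun x => Real.smoothTransition ((v x - t) / ε)

section LevelCut

variable {n : ℕ} {Ω : Set (EuclideanSpace ℝ (Fin n))} {v : EuclideanSpace ℝ (Fin n) → ℝ}
  {t ε : ℝ}

theorem mem_of_mem_closure_of_pos (hΩ : IsOpen Ω) (hv0 : ∀ x ∈ frontier Ω, v x = 0)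
    (ht : 0 < t) {x : EuclideanSpace ℝ (Fin n)} (hx : x ∈ closure Ω) (hxt : t ≤ v x) : x ∈ Ω := by
  by_contra hxΩ
  have := hv0 x (by rw [hΩ.frontier_eq]; exact ⟨hx, hxΩ⟩)
  linarith

theorem isCompact_superlevel (hΩb : IsBounded Ω) (hv : Continuous v) (t : ℝ) :
    IsCompact (closure Ω ∩ {x | t ≤ v x}) :=
  hΩb.isCompact_closure.inter_right (isClosed_le continuous_const hv)

theorem levelCut_eventuallyEq_of_mem (hΩ : IsOpen Ω) {x : EuclideanSpace ℝ (Fin n)} (hx : x ∈ Ω) :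
    levelCut Ω v t ε =ᶠ[𝓝 x] fun y => Real.smoothTransition ((v y - t) / ε) := by
  filter_upwards [hΩ.mem_nhds hx] with y hy
  exact Set.indicator_of_mem hy _

theorem levelCut_eventuallyEq_of_notMem (hΩ : IsOpen Ω) (hv : Continuous v)
    (hv0 : ∀ x ∈ frontier Ω, v x = 0) (ht : 0 < t) (hε : 0 < ε)
    {x : EuclideanSpace ℝ (Fin n)} (hx : x ∉ Ω) : levelCut Ω v t ε =ᶠ[𝓝 x] fun _ => 0 := by
  by_cases hxc : x ∈ closure Ω
  · have hlt : v x < t := by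
      by_contra! h
      exact hx (mem_of_mem_closure_of_pos hΩ hv0 ht hxc h)
    filter_upwards [hv.continuousAt.eventually_lt continuousAt_const hlt] with y hy
    refine Set.indicator_apply_eq_zero.2 fun _ => Real.smoothTransition.zero_of_nonpos ?_
    exact div_nonpos_of_nonpos_of_nonneg (by linarith) hε.le
  · filter_upwards [isClosed_closure.isOpen_compl.mem_nhds hxc] with y hy
    exact Set.indicator_of_notMem (fun h => hy (subset_closure h)) _

theorem contDiff_levelCut (hΩ : IsOpen Ω) (hv : ContDiff ℝ (⊤ : ℕ∞) v)
    (hv0 : ∀ x ∈ frontier Ω, v x = 0) (ht : 0 < t) (hε : 0 < ε) :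
    ContDiff ℝ (⊤ : ℕ∞) (levelCut Ω v t ε) := by
  rw [contDiff_iff_contDiffAt]
  intro x
  by_cases hx : x ∈ Ω
  · refine ContDiffAt.congr_of_eventuallyEq ?_ (levelCut_eventuallyEq_of_mem hΩ hx)
    exact (Real.smoothTransition.contDiff.comp
      ((hv.sub contDiff_const).div_const ε)).contDiffAt
  · exact contDiffAt_const.congr_of_eventuallyEq
      (levelCut_eventuallyEq_of_notMem hΩ hv.continuous hv0 ht hε hx)

theorem hasCompactSupport_levelCut (hΩb : IsBounded Ω) (hv : Continuous v) (hε : 0 < ε) :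
    HasCompactSupport (levelCut Ω v t ε) := by
  refine HasCompactSupport.of_support_subset_isCompact (isCompact_superlevel hΩb hv t) ?_
  intro x hx
  rw [Function.mem_support] at hx
  have hxΩ : x ∈ Ω := Set.mem_of_indicator_ne_zero hx
  refine ⟨subset_closure hxΩ, ?_⟩
  by_contra! h
  refine hx (Set.indicator_apply_eq_zero.2 fun _ => Real.smoothTransition.zero_of_nonpos ?_)
  simp only [Set.mem_ofPred_eq, not_le] at h
  exact div_nonpos_of_nonpos_of_nonneg (by linarith) hε.le

theorem gradient_levelCut_of_mem (hΩ : IsOpen Ω) (hv : Differentiable ℝ v)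
    {x : EuclideanSpace ℝ (Fin n)} (hx : x ∈ Ω) :
    gradient (levelCut Ω v t ε) x =
      (deriv Real.smoothTransition ((v x - t) / ε) / ε) • gradient v x := by
  have h1 : HasDerivAt Real.smoothTransition (deriv Real.smoothTransition ((v x - t) / ε))
      ((v x - t) / ε) :=
    ((Real.smoothTransition.contDiff (n := 1)).differentiable one_ne_zero).differentiableAt.hasDerivAt
  have h2 : HasFDerivAt (fun y => (v y - t) / ε) (ε⁻¹ • fderiv ℝ v x) x := by
    simpa only [div_eq_mul_inv] using ((hv x).hasFDerivAt.sub_const t).mul_const ε⁻¹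
  have h3 := (h1.comp_hasFDerivAt x h2).congr_of_eventuallyEq (levelCut_eventuallyEq_of_mem hΩ hx)
  rw [gradient, h3.fderiv, gradient, map_smul, map_smul, smul_smul, ← div_eq_mul_inv]

theorem gradient_levelCut_of_notMem (hΩ : IsOpen Ω) (hv : Continuous v)
    (hv0 : ∀ x ∈ frontier Ω, v x = 0) (ht : 0 < t) (hε : 0 < ε)
    {x : EuclideanSpace ℝ (Fin n)} (hx : x ∉ Ω) : gradient (levelCut Ω v t ε) x = 0 := by
  rw [gradient, (levelCut_eventuallyEq_of_notMem hΩ hv hv0 ht hε hx).fderiv_eq]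
  simp

theorem norm_gradient_levelCut_le (hΩ : IsOpen Ω) (hv : Differentiable ℝ v)
    (hv0 : ∀ x ∈ frontier Ω, v x = 0) (ht : 0 < t) (hε : 0 < ε) {D : ℝ}
    (hD : ∀ y, deriv Real.smoothTransition y ≤ D) (x : EuclideanSpace ℝ (Fin n)) :
    ‖gradient (levelCut Ω v t ε) x‖ ≤
      (Ω ∩ {x | t < v x ∧ v x < t + ε}).indicator (fun x => D / ε * ‖gradient v x‖) x := by
  by_cases hx : x ∈ Ω
  · rw [gradient_levelCut_of_mem hΩ hv hx, norm_smul]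
    by_cases hxt : t < v x ∧ v x < t + ε
    · have hmem : x ∈ Ω ∩ {x | t < v x ∧ v x < t + ε} := ⟨hx, hxt⟩
      rw [Set.indicator_of_mem hmem, Real.norm_of_nonneg
        (div_nonneg Real.smoothTransition.monotone.deriv_nonneg hε.le)]
      gcongr
      exact hD _
    · rw [Set.indicator_of_notMem fun h => hxt h.2, deriv_smoothTransition_eq_zero]
      · simp
      · by_contra! h
        rw [div_lt_one hε, div_pos_iff_of_pos_right hε] at h
        exact hxt ⟨by linarith, by linarith⟩
  · rw [gradient_levelCut_of_notMem hΩ hv.continuous hv0 ht hε hx,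
      Set.indicator_of_notMem fun h => hx h.1, norm_zero]

theorem gradient_ne_zero_of_levelCut (hΩ : IsOpen Ω) (hv : Differentiable ℝ v)
    (hv0 : ∀ x ∈ frontier Ω, v x = 0) (ht : 0 < t) (hε : 0 < ε)
    {x : EuclideanSpace ℝ (Fin n)} (hx : gradient (levelCut Ω v t ε) x ≠ 0) :
    x ∈ Ω ∧ t < v x ∧ v x < t + ε ∧ gradient v x ≠ 0 := by
  obtain ⟨D, -, hD⟩ := exists_deriv_smoothTransition_le
  have h := (norm_pos_iff.2 hx).trans_le (norm_gradient_levelCut_le hΩ hv hv0 ht hε hD x)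
  have hmem := Set.mem_of_indicator_ne_zero h.ne'
  refine ⟨hmem.1, hmem.2.1, hmem.2.2, fun h0 => ?_⟩
  rw [Set.indicator_of_mem hmem, h0] at h
  simp at h

theorem abs_regDiv_levelCut (hn : 2 ≤ n) (hΩ : IsOpen Ω) (hv : ContDiff ℝ (⊤ : ℕ∞) v)
    (hv0 : ∀ x ∈ frontier Ω, v x = 0) (ht : 0 < t) (hε : 0 < ε)
    {x : EuclideanSpace ℝ (Fin n)} (hx : gradient (levelCut Ω v t ε) x ≠ 0) :
    |regDiv (levelCut Ω v t ε) 0 x| = (n - 1) * |meanCurv v x| := by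
  have hvd : Differentiable ℝ v := hv.differentiable (by simp)
  have hu := contDiff_levelCut hΩ hv hv0 ht hε
  have hn' : (2 : ℝ) ≤ n := by exact_mod_cast hn
  rw [← divg_regNormal hu (by simpa using hx), regNormal_zero]
  have hev : (fun y => ‖gradient (levelCut Ω v t ε) y‖⁻¹ • gradient (levelCut Ω v t ε) y)
      =ᶠ[𝓝 x] fun y => ‖gradient v y‖⁻¹ • gradient v y := by
    filter_upwards [hu.gradient'.continuous.continuousAt.eventually_ne hx] with y hy
    obtain ⟨hyΩ, -, -, hgy⟩ := gradient_ne_zero_of_levelCut hΩ hvd hv0 ht hε hy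
    rw [gradient_levelCut_of_mem hΩ hvd hyΩ] at hy ⊢
    set c := deriv Real.smoothTransition ((v y - t) / ε) / ε with hc
    have hc0 : 0 ≤ c := div_nonneg Real.smoothTransition.monotone.deriv_nonneg hε.le
    have hc1 : c ≠ 0 := fun h => hy (by rw [h, zero_smul])
    rw [norm_smul, Real.norm_of_nonneg hc0, smul_smul, mul_inv, mul_right_comm,
      inv_mul_cancel₀ hc1, one_mul]
  have hd : divg (fun y => ‖gradient (levelCut Ω v t ε) y‖⁻¹ • gradient (levelCut Ω v t ε) y) x
      = divg (fun y => ‖gradient v y‖⁻¹ • gradient v y) x := by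
    unfold divg
    rw [hev.fderiv_eq]
  rw [hd, meanCurv, abs_mul, abs_neg, abs_of_nonneg (by
    have : (0 : ℝ) ≤ n - 1 := by linarith
    positivity : (0 : ℝ) ≤ 1 / (n - 1)), ← mul_assoc,
    mul_one_div_cancel (by linarith), one_mul]

end LevelCut

theorem integrable_norm_gradient_mul_regDiv {n : ℕ} {u : EuclideanSpace ℝ (Fin n) → ℝ}
    (hu : ContDiff ℝ (⊤ : ℕ∞) u) (hc : HasCompactSupport u) :
    Integrable fun x => ‖gradient u x‖ * |regDiv u 0 x| := by
  have hN : ContDiff ℝ 1 (gradient u) := hu.gradient'.of_le (by norm_cast)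
  refine Integrable.mono' (g := fun x => 2 * n * ‖fderiv ℝ (gradient u) x‖) ?_ ?_ ?_
  · refine (continuous_const.mul (hN.continuous_fderiv one_ne_zero).norm
      ).integrable_of_hasCompactSupport ((hc.gradient'.fderiv ℝ).mono fun x hx => ?_)
    simp only [Function.mem_support] at hx ⊢
    rintro h
    exact hx (by simp [h])
  · exact (hN.continuous.norm.measurable.mul (measurable_regDiv hu 0).abs).aestronglyMeasurable
  · refine ae_of_all _ fun x => ?_
    rw [Real.norm_of_nonneg (by positivity)]
    exact norm_gradient_mul_abs_regDiv_le u 0 x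

theorem integrable_norm_gradient {n : ℕ} {u : EuclideanSpace ℝ (Fin n) → ℝ}
    (hu : ContDiff ℝ (⊤ : ℕ∞) u) (hc : HasCompactSupport u) :
    Integrable fun x => ‖gradient u x‖ :=
  hu.gradient'.continuous.norm.integrable_of_hasCompactSupport hc.gradient'.norm

theorem isFiniteMeasure_levelMeasure {n : ℕ} {u : EuclideanSpace ℝ (Fin n) → ℝ}
    (hu : ContDiff ℝ (⊤ : ℕ∞) u) (hc : HasCompactSupport u) : IsFiniteMeasure (levelMeasure u) :=
  isFiniteMeasure_withDensity_ofReal (integrable_norm_gradient hu hc).2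

theorem isFiniteMeasure_curvMeasure {n : ℕ} {u : EuclideanSpace ℝ (Fin n) → ℝ}
    (hu : ContDiff ℝ (⊤ : ℕ∞) u) (hc : HasCompactSupport u) : IsFiniteMeasure (curvMeasure u) :=
  isFiniteMeasure_withDensity_ofReal (integrable_norm_gradient_mul_regDiv hu hc).2

theorem one_le_lintegral_segment {n : ℕ} {u : EuclideanSpace ℝ (Fin n) → ℝ}
    (hu : ContDiff ℝ (⊤ : ℕ∞) u) {e y : EuclideanSpace ℝ (Fin n)} (he : ‖e‖ = 1) {ρ : ℝ}
    (hρ : 0 < ρ) (h0 : u y = 0) (h1 : u (y + ρ • e) = 1) :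
    1 ≤ ∫⁻ τ in Set.Ioc (0 : ℝ) 1,
      ENNReal.ofReal ρ * ENNReal.ofReal ‖gradient u (y + (τ * ρ) • e)‖ := by
  have hud : Differentiable ℝ u := hu.differentiable (by simp)
  have hNc := hu.gradient'.continuous
  have hline : ∀ τ : ℝ, HasDerivAt (fun τ : ℝ => u (y + (τ * ρ) • e))
      (fderiv ℝ u (y + (τ * ρ) • e) (ρ • e)) τ := by
    intro τ
    have h2 : HasDerivAt (fun τ : ℝ => y + (τ * ρ) • e) (ρ • e) τ := by
      simpa using (((hasDerivAt_id τ).mul_const ρ).smul_const e).const_add y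
    exact (hud _).hasFDerivAt.comp_hasDerivAt τ h2
  have hcont : Continuous fun τ : ℝ => fderiv ℝ u (y + (τ * ρ) • e) (ρ • e) :=
    ((hu.continuous_fderiv (by simp)).comp (by fun_prop)).clm_apply continuous_const
  have hgc : Continuous fun τ : ℝ => ρ * ‖gradient u (y + (τ * ρ) • e)‖ :=
    continuous_const.mul ((hNc.comp (by fun_prop)).norm)
  have i1 := hcont.intervalIntegrable (μ := volume) 0 1
  have i2 := hgc.intervalIntegrable (μ := volume) 0 1
  have hftc := intervalIntegral.integral_eq_sub_of_hasDerivAt (a := 0) (b := 1)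
    (fun τ _ => hline τ) i1
  have hle : (1 : ℝ) ≤ ∫ τ in Set.Ioc (0 : ℝ) 1, ρ * ‖gradient u (y + (τ * ρ) • e)‖ := by
    rw [← intervalIntegral.integral_of_le zero_le_one]
    have : (1 : ℝ) = ∫ τ in (0 : ℝ)..1, fderiv ℝ u (y + (τ * ρ) • e) (ρ • e) := by
      rw [hftc]; simp [h0, h1]
    refine this.le.trans (intervalIntegral.integral_mono_on zero_le_one i1 i2 fun τ _ => ?_)
    rw [← inner_gradient_left]
    refine (real_inner_le_norm _ _).trans_eq ?_
    rw [norm_smul, he, mul_one, Real.norm_of_nonneg hρ.le, mul_comm]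
  calc (1 : ℝ≥0∞) = ENNReal.ofReal 1 := by simp
    _ ≤ ENNReal.ofReal (∫ τ in Set.Ioc (0 : ℝ) 1, ρ * ‖gradient u (y + (τ * ρ) • e)‖) :=
      ENNReal.ofReal_le_ofReal hle
    _ = ∫⁻ τ in Set.Ioc (0 : ℝ) 1, ENNReal.ofReal (ρ * ‖gradient u (y + (τ * ρ) • e)‖) :=
      ofReal_integral_eq_lintegral_ofReal (hgc.integrableOn_Ioc)
        (ae_of_all _ fun τ => by simp only [Pi.zero_apply]; positivity)
    _ = _ := by simp only [ENNReal.ofReal_mul hρ.le]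

theorem le_levelMeasure_closedBall {m n : ℕ} (hn : n = m + 1)
    {u : EuclideanSpace ℝ (Fin n) → ℝ}
    (hu : ContDiff ℝ (⊤ : ℕ∞) u) (hc : HasCompactSupport u)
    {x₀ e : EuclideanSpace ℝ (Fin n)} (he : ‖e‖ = 1) {ρ : ℝ} (hρ : 0 < ρ)
    (h0 : ∀ y ∈ Metric.ball (x₀ - (ρ / 2) • e) (ρ / 4), u y = 0)
    (h1 : ∀ y ∈ Metric.ball (x₀ + (ρ / 2) • e) (ρ / 4), u y = 1) :
    volume.real (Metric.ball (0 : EuclideanSpace ℝ (Fin n)) 1) / 4 ^ n * ρ ^ m ≤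
      (levelMeasure u).real (Metric.closedBall x₀ ρ) := by
  have hfin := isFiniteMeasure_levelMeasure hu hc
  have hNc := hu.gradient'.continuous
  set A := Metric.ball (x₀ - (ρ / 2) • e) (ρ / 4) with hA
  set B := Metric.closedBall x₀ ρ with hB
  have hBm : MeasurableSet B := Metric.isClosed_closedBall.measurableSet
  have hmeas : Measurable fun x => ENNReal.ofReal ‖gradient u x‖ :=
    hNc.norm.measurable.ennreal_ofReal
  have hshift : ∀ y ∈ A, y + ρ • e ∈ Metric.ball (x₀ + (ρ / 2) • e) (ρ / 4) := by
    intro y hy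
    rw [hA, mem_ball_iff_norm] at hy
    rw [mem_ball_iff_norm]
    convert hy using 2
    module
  have hstay : ∀ y ∈ A, ∀ τ ∈ Set.Ioc (0 : ℝ) 1, y + (τ * ρ) • e ∈ B := by
    intro y hy τ hτ
    rw [hA, mem_ball_iff_norm] at hy
    rw [hB, mem_closedBall_iff_norm]
    have h2 : y + (τ * ρ) • e - x₀ = (y - (x₀ - (ρ / 2) • e)) + ((τ - 1 / 2) * ρ) • e := by
      module
    rw [h2]
    refine (norm_add_le _ _).trans ?_
    rw [norm_smul, he, mul_one, Real.norm_eq_abs, abs_mul, abs_of_pos hρ]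
    have : |τ - 1 / 2| ≤ 1 / 2 := by rw [abs_le]; constructor <;> linarith [hτ.1, hτ.2]
    nlinarith
  have key : volume A ≤ ENNReal.ofReal ρ * levelMeasure u B := by
    calc volume A = ∫⁻ _ in A, 1 := by simp
      _ ≤ ∫⁻ y in A, ∫⁻ τ in Set.Ioc (0 : ℝ) 1,
          ENNReal.ofReal ρ * ENNReal.ofReal ‖gradient u (y + (τ * ρ) • e)‖ :=
        setLIntegral_mono_ae' Metric.isOpen_ball.measurableSet (ae_of_all _ fun y hy =>
          one_le_lintegral_segment hu he hρ (h0 y hy) (h1 _ (hshift y hy)))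
      _ = ∫⁻ τ in Set.Ioc (0 : ℝ) 1, ∫⁻ y in A,
          ENNReal.ofReal ρ * ENNReal.ofReal ‖gradient u (y + (τ * ρ) • e)‖ := by
        refine lintegral_lintegral_swap (Measurable.aemeasurable ?_)
        refine measurable_const.mul (hmeas.comp ?_)
        exact (by fun_prop : Continuous fun z : EuclideanSpace ℝ (Fin n) × ℝ =>
          z.1 + (z.2 * ρ) • e).measurable
      _ ≤ ∫⁻ τ in Set.Ioc (0 : ℝ) 1, ENNReal.ofReal ρ * levelMeasure u B := by
        refine setLIntegral_mono_ae' measurableSet_Ioc (ae_of_all _ fun τ hτ => ?_)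
        have hm2 : Measurable fun y => ENNReal.ofReal ‖gradient u (y + (τ * ρ) • e)‖ :=
          hmeas.comp (measurable_id.add_const _)
        rw [lintegral_const_mul _ hm2]
        gcongr
        calc _ ≤ ∫⁻ y in A, B.indicator (fun x => ENNReal.ofReal ‖gradient u x‖)
              (y + (τ * ρ) • e) := by
              refine setLIntegral_mono_ae' Metric.isOpen_ball.measurableSet
                (ae_of_all _ fun y hy => ?_)
              rw [Set.indicator_of_mem (hstay y hy τ hτ)]
          _ ≤ ∫⁻ y, B.indicator (fun x => ENNReal.ofReal ‖gradient u x‖)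
              (y + (τ * ρ) • e) := setLIntegral_le_lintegral _ _
          _ = ∫⁻ y, B.indicator (fun x => ENNReal.ofReal ‖gradient u x‖) y :=
              lintegral_add_right_eq_self _ _
          _ = _ := by rw [lintegral_indicator hBm, levelMeasure, withDensity_apply _ hBm]
      _ = _ := by simp
  have hvol : volume.real A = (ρ / 4) ^ n * volume.real (Metric.ball (0 : EuclideanSpace ℝ (Fin n)) 1) := by
    rw [hA, Measure.real, Measure.addHaar_ball_of_pos _ _ (by positivity), ENNReal.toReal_mul,
      ENNReal.toReal_ofReal (by positivity)]
    simp [Measure.real]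
  have key2 : volume.real A ≤ ρ * (levelMeasure u).real B := by
    have := ENNReal.toReal_mono (ENNReal.mul_ne_top ENNReal.ofReal_ne_top (measure_ne_top _ _)) key
    rwa [ENNReal.toReal_mul, ENNReal.toReal_ofReal hρ.le] at this
  rw [hvol] at key2
  refine le_of_mul_le_mul_left (le_trans (le_of_eq ?_) key2) hρ
  subst hn
  rw [div_pow, pow_succ ρ m]
  ring

theorem exists_isoperimetric_const (m : ℕ) {n : ℕ} (hm : 1 ≤ m) (hn : n = m + 1) :
    ∃ C : ℝ, 0 < C ∧ ∀ (u : EuclideanSpace ℝ (Fin n) → ℝ), ContDiff ℝ (⊤ : ℕ∞) u →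
      HasCompactSupport u → ∀ S : Set (EuclideanSpace ℝ (Fin n)), (∀ x ∈ S, u x = 1) →
      volume.real S ≤ C * (levelMeasure u).real Set.univ ^ ((n : ℝ) / m) := by
  have hm0 : (0 : ℝ) < m := by exact_mod_cast hm
  have hnm : (n : ℝ) = m + 1 := by rw [hn]; push_cast; ring
  have hp : Real.HolderConjugate (Module.finrank ℝ (EuclideanSpace ℝ (Fin n)))
      ((n : ℝ) / m) := by
    rw [finrank_euclideanSpace, Fintype.card_fin, Real.holderConjugate_iff]
    refine ⟨by linarith, ?_⟩
    rw [hnm]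
    field_simp
    ring
  refine ⟨lintegralPowLePowLIntegralFDerivConst (volume : Measure (EuclideanSpace ℝ (Fin n)))
    ((n : ℝ) / m) + 1, by positivity, fun u hu hc S hS => ?_⟩
  have hfin := isFiniteMeasure_levelMeasure hu hc
  have h := lintegral_pow_le_pow_lintegral_fderiv (volume : Measure (EuclideanSpace ℝ (Fin n)))
    (hu.of_le (by norm_cast : (1 : WithTop ℕ∞) ≤ (⊤ : ℕ∞))) hc hp
  have hS' : volume S ≤ ∫⁻ x, ‖u x‖ₑ ^ ((n : ℝ) / m) := by
    have hmS : MeasurableSet {x | u x = 1} :=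
      (isClosed_eq hu.continuous continuous_const).measurableSet
    calc volume S ≤ volume {x | u x = 1} := measure_mono hS
      _ = ∫⁻ x in {x | u x = 1}, 1 := by simp
      _ = ∫⁻ x in {x | u x = 1}, ‖u x‖ₑ ^ ((n : ℝ) / m) := by
        refine setLIntegral_congr_fun hmS fun x hx => ?_
        have : u x = 1 := hx
        simp [this]
      _ ≤ _ := setLIntegral_le_lintegral _ _
  have hσ : ∫⁻ x, ‖fderiv ℝ u x‖ₑ = levelMeasure u Set.univ := by
    rw [levelMeasure, withDensity_apply _ MeasurableSet.univ, Measure.restrict_univ]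
    refine lintegral_congr fun x => ?_
    rw [norm_gradient_eq, ofReal_norm]
  rw [hσ] at h
  have h2 := ENNReal.toReal_mono (ENNReal.mul_ne_top ENNReal.coe_ne_top
    (ENNReal.rpow_ne_top_of_nonneg (by positivity) (measure_ne_top _ _))) (hS'.trans h)
  rw [ENNReal.toReal_mul, ← ENNReal.toReal_rpow, ENNReal.coe_toReal] at h2
  refine h2.trans ?_
  have : 0 ≤ (levelMeasure u).real Set.univ ^ ((n : ℝ) / m) := by positivity
  rw [add_mul, one_mul]
  exact le_add_of_nonneg_right this

theorem abs_sub_sub_inner_gradient_le {n : ℕ} {v : EuclideanSpace ℝ (Fin n) → ℝ}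
    (hv : Differentiable ℝ v) {x₀ y : EuclideanSpace ℝ (Fin n)} {ρ C : ℝ}
    (hC : ∀ z ∈ Metric.closedBall x₀ ρ, ‖fderiv ℝ v z - fderiv ℝ v x₀‖ ≤ C)
    (hy : y ∈ Metric.closedBall x₀ ρ) :
    |v y - v x₀ - inner ℝ (gradient v x₀) (y - x₀)| ≤ C * ‖y - x₀‖ := by
  rw [inner_gradient_left, ← Real.norm_eq_abs]
  have hρ : 0 ≤ ρ := dist_nonneg.trans (Metric.mem_closedBall.1 hy)
  exact (convex_closedBall x₀ ρ).norm_image_sub_le_of_norm_hasFDerivWithin_le'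
    (fun z _ => (hv z).hasFDerivAt.hasFDerivWithinAt) hC (Metric.mem_closedBall_self hρ) hy

section LevelCut

variable {n : ℕ} {Ω : Set (EuclideanSpace ℝ (Fin n))} {v : EuclideanSpace ℝ (Fin n) → ℝ}
  {t : ℝ}

theorem exists_radius_fderiv_near (hΩ : IsOpen Ω) (hΩb : IsBounded Ω)
    (hv : ContDiff ℝ (⊤ : ℕ∞) v)
    (hv0 : ∀ x ∈ frontier Ω, v x = 0) (ht : 0 < t) {C : ℝ} (hC : 0 < C) :
    ∃ ρ : ℝ, 0 < ρ ∧ ∀ x₀ ∈ Ω, t ≤ v x₀ → Metric.closedBall x₀ ρ ⊆ Ω ∧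
      ∀ z ∈ Metric.closedBall x₀ ρ, ‖fderiv ℝ v z - fderiv ℝ v x₀‖ ≤ C := by
  have hK := isCompact_superlevel hΩb hv.continuous t
  obtain ⟨δ, hδ, hsub⟩ := hK.exists_cthickening_subset_open hΩ
    fun x hx => mem_of_mem_closure_of_pos hΩ hv0 ht hx.1 hx.2
  have huc := hK.cthickening (r := δ) |>.uniformContinuousOn_of_continuous
    (hv.continuous_fderiv (by simp)).continuousOn
  obtain ⟨δ₂, hδ₂, h⟩ := Metric.uniformContinuousOn_iff.1 huc C hC
  refine ⟨min δ (δ₂ / 2), by positivity, fun x₀ hx₀ hxt => ?_⟩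
  have hmem : x₀ ∈ closure Ω ∩ {x | t ≤ v x} := ⟨subset_closure hx₀, hxt⟩
  have hb : Metric.closedBall x₀ (min δ (δ₂ / 2)) ⊆
      Metric.cthickening δ (closure Ω ∩ {x | t ≤ v x}) :=
    (Metric.closedBall_subset_closedBall (min_le_left _ _)).trans
      (Metric.closedBall_subset_cthickening hmem δ)
  refine ⟨hb.trans hsub, fun z hz => ?_⟩
  rw [← dist_eq_norm]
  refine (h z (hb hz) x₀ (Metric.self_subset_cthickening _ hmem) ?_).le
  have := (Metric.mem_closedBall.1 hz).trans (min_le_right _ _)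
  linarith

theorem exists_density_levelCut {m : ℕ} (hn : n = m + 1) (hΩ : IsOpen Ω) (hΩb : IsBounded Ω)
    (hv : ContDiff ℝ (⊤ : ℕ∞) v)
    (hv0 : ∀ x ∈ frontier Ω, v x = 0) (ht : 0 < t) {γ : ℝ} (hγ : 0 < γ) :
    ∃ ε₀ : ℝ, 0 < ε₀ ∧ ∀ ε, 0 < ε → ε ≤ ε₀ → ∀ x₀ ∈ Ω, t < v x₀ → v x₀ < t + ε →
      γ ≤ ‖gradient v x₀‖ → ∃ ρ, 0 < ρ ∧
      volume.real (Metric.ball (0 : EuclideanSpace ℝ (Fin n)) 1) / 4 ^ n * ρ ^ m ≤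
        (levelMeasure (levelCut Ω v t ε)).real (Metric.closedBall x₀ ρ) := by
  have hvd : Differentiable ℝ v := hv.differentiable (by simp)
  obtain ⟨ρ, hρ, h⟩ := exists_radius_fderiv_near hΩ hΩb hv hv0 ht (by positivity : 0 < γ / 8)
  refine ⟨γ * ρ / 8, by positivity, fun ε hε hε₀ x₀ hx₀ ht1 ht2 hg => ⟨ρ, hρ, ?_⟩⟩
  obtain ⟨hsub, hD⟩ := h x₀ hx₀ ht1.le
  set N := gradient v x₀ with hN
  have hNp : 0 < ‖N‖ := hγ.trans_le hg
  have he : ‖‖N‖⁻¹ • N‖ = 1 := by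
    rw [norm_smul, norm_inv, norm_norm, inv_mul_cancel₀ hNp.ne']
  set e := ‖N‖⁻¹ • N with hed
  have hNe : inner ℝ N e = ‖N‖ := by
    rw [hed, inner_smul_right, real_inner_self_eq_norm_sq]
    field_simp
  have hball : ∀ (a : ℝ), |a| = ρ / 2 → ∀ y ∈ Metric.ball (x₀ + a • e) (ρ / 4),
      y ∈ Metric.closedBall x₀ ρ ∧ |inner ℝ N (y - x₀) - a * ‖N‖| ≤ ‖N‖ * (ρ / 4) := by
    intro a ha y hy
    rw [mem_ball_iff_norm] at hy
    have hdec : y - x₀ = (y - (x₀ + a • e)) + a • e := by abel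
    constructor
    · rw [mem_closedBall_iff_norm, hdec]
      refine (norm_add_le _ _).trans ?_
      rw [norm_smul, he, Real.norm_eq_abs, ha]
      linarith
    · rw [hdec, inner_add_right, inner_smul_right, hNe, add_sub_cancel_right]
      refine (abs_real_inner_le_norm _ _).trans ?_
      gcongr
  refine le_levelMeasure_closedBall hn (contDiff_levelCut hΩ hv hv0 ht hε)
    (hasCompactSupport_levelCut hΩb hv.continuous hε) he hρ ?_ ?_
  · intro y hy
    rw [sub_eq_add_neg, ← neg_smul] at hy
    obtain ⟨hyb, hyi⟩ := hball (-(ρ / 2)) (by rw [abs_neg, abs_of_pos (by positivity)]) y hy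
    have hT := abs_sub_sub_inner_gradient_le hvd hD hyb
    rw [mem_closedBall_iff_norm] at hyb
    rw [abs_le] at hyi hT
    have h1 : γ / 8 * ‖y - x₀‖ ≤ γ / 8 * ρ := by gcongr
    have h2 : γ * ρ ≤ ‖N‖ * ρ := by gcongr
    refine Set.indicator_apply_eq_zero.2 fun _ => Real.smoothTransition.zero_of_nonpos ?_
    refine div_nonpos_of_nonpos_of_nonneg ?_ hε.le
    linarith [hyi.2, hT.2]
  · intro y hy
    obtain ⟨hyb, hyi⟩ := hball (ρ / 2) (abs_of_pos (by positivity)) y hy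
    have hT := abs_sub_sub_inner_gradient_le hvd hD hyb
    rw [levelCut, Set.indicator_of_mem (hsub hyb)]
    rw [mem_closedBall_iff_norm] at hyb
    rw [abs_le] at hyi hT
    have h1 : γ / 8 * ‖y - x₀‖ ≤ γ / 8 * ρ := by gcongr
    have h2 : γ * ρ ≤ ‖N‖ * ρ := by gcongr
    refine Real.smoothTransition.one_of_one_le ?_
    rw [one_le_div hε]
    linarith [hyi.1, hT.1]

theorem levelMeasure_levelCut_univ_le (hΩ : IsOpen Ω) (hΩb : IsBounded Ω)
    (hv : ContDiff ℝ (⊤ : ℕ∞) v) (hv0 : ∀ x ∈ frontier Ω, v x = 0) (ht : 0 < t) {D : ℝ}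
    (hD0 : 0 < D) (hD : ∀ y, deriv Real.smoothTransition y ≤ D) {ε γ : ℝ} (hε : 0 < ε)
    (hγ : 0 < γ)
    {G : Set (EuclideanSpace ℝ (Fin n))}
    (hG : ∀ x ∈ Ω, t < v x → v x < t + ε → γ ≤ ‖gradient v x‖ → x ∈ G) :
    (levelMeasure (levelCut Ω v t ε)).real Set.univ ≤
      (levelMeasure (levelCut Ω v t ε)).real G +
        D / ε * γ * (volume.restrict Ω).real {x | t < v x ∧ v x < t + ε} := by
  set u := levelCut Ω v t ε with hu
  have hus := contDiff_levelCut hΩ hv hv0 ht hε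
  have hfin := isFiniteMeasure_levelMeasure hus
    (hasCompactSupport_levelCut hΩb hv.continuous hε)
  have hvd : Differentiable ℝ v := hv.differentiable (by simp)
  have hgm : Measurable fun x => ‖gradient v x‖ := hv.gradient'.continuous.norm.measurable
  have hNm : MeasurableSet {x | ‖gradient v x‖ < γ} := measurableSet_lt hgm measurable_const
  have hZm : MeasurableSet {x | gradient u x = 0} :=
    (isClosed_eq hus.gradient'.continuous continuous_const).measurableSet
  have hsm : MeasurableSet {x | t < v x ∧ v x < t + ε} :=
    (measurableSet_lt measurable_const hv.continuous.measurable).inter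
      (measurableSet_lt hv.continuous.measurable measurable_const)
  have hcov : Set.univ ⊆ (G ∪ {x | ‖gradient v x‖ < γ}) ∪ {x | gradient u x = 0} := by
    intro x _
    by_cases hx : gradient u x = 0
    · exact Or.inr hx
    obtain ⟨h1, h2, h3, -⟩ := gradient_ne_zero_of_levelCut hΩ hvd hv0 ht hε hx
    rcases lt_or_ge ‖gradient v x‖ γ with h | h
    · exact Or.inl (Or.inr h)
    · exact Or.inl (Or.inl (hG x h1 h2 h3 h))
  have hZ : (levelMeasure u).real {x | gradient u x = 0} = 0 := by
    rw [Measure.real, levelMeasure, withDensity_apply _ hZm, setLIntegral_congr_fun (g := fun _ => 0)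
      hZm (fun x hx => by rw [Set.mem_ofPred_eq] at hx; simp [hx])]
    simp
  have hN : (levelMeasure u).real {x | ‖gradient v x‖ < γ} ≤
      D / ε * γ * (volume.restrict Ω).real {x | t < v x ∧ v x < t + ε} := by
    have hvol : volume (Ω ∩ {x | t < v x ∧ v x < t + ε}) ≠ ⊤ :=
      (hΩb.subset Set.inter_subset_left).measure_lt_top.ne
    have : levelMeasure u {x | ‖gradient v x‖ < γ} ≤
        ENNReal.ofReal (D / ε * γ) * volume (Ω ∩ {x | t < v x ∧ v x < t + ε}) := by
      rw [levelMeasure, withDensity_apply _ hNm, ← lintegral_indicator_const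
        (hΩ.measurableSet.inter hsm)]
      refine (setLIntegral_mono_ae' hNm (ae_of_all _ fun x hx => ?_)).trans
        (setLIntegral_le_lintegral _ _)
      rw [Set.mem_ofPred_eq] at hx
      have hle := norm_gradient_levelCut_le hΩ hvd hv0 ht hε hD x
      by_cases hmem : x ∈ Ω ∩ {x | t < v x ∧ v x < t + ε}
      · rw [Set.indicator_of_mem hmem] at hle ⊢
        refine ENNReal.ofReal_le_ofReal (hle.trans ?_)
        gcongr
      · rw [Set.indicator_of_notMem hmem] at hle ⊢
        simpa using hle
    rw [Measure.real, Measure.real, Measure.restrict_apply hsm, Set.inter_comm _ Ω,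
      ← ENNReal.toReal_ofReal (by positivity : 0 ≤ D / ε * γ), ← ENNReal.toReal_mul]
    exact ENNReal.toReal_mono (ENNReal.mul_ne_top ENNReal.ofReal_ne_top hvol) this
  calc _ ≤ (levelMeasure u).real ((G ∪ {x | ‖gradient v x‖ < γ}) ∪ {x | gradient u x = 0}) :=
        measureReal_mono hcov
    _ ≤ (levelMeasure u).real (G ∪ {x | ‖gradient v x‖ < γ}) +
        (levelMeasure u).real {x | gradient u x = 0} := measureReal_union_le _ _
    _ ≤ (levelMeasure u).real G + (levelMeasure u).real {x | ‖gradient v x‖ < γ} + 0 := by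
        rw [hZ]; gcongr; exact measureReal_union_le _ _
    _ ≤ _ := by rw [add_zero]; gcongr

end LevelCut

theorem curvMeasure_univ_le {n : ℕ} {u : EuclideanSpace ℝ (Fin n) → ℝ}
    (hu : ContDiff ℝ (⊤ : ℕ∞) u) {r : ℝ} (hr : 1 ≤ r) :
    curvMeasure u Set.univ ≤ (∫⁻ x, ‖regDiv u 0 x‖ₑ ^ r ∂levelMeasure u) ^ (1 / r) *
      levelMeasure u Set.univ ^ (1 - 1 / r) := by
  have hgm : Measurable fun x => ENNReal.ofReal ‖gradient u x‖ :=
    hu.gradient'.continuous.norm.measurable.ennreal_ofReal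
  have h := eLpNorm'_le_eLpNorm'_mul_rpow_measure_univ (μ := levelMeasure u) one_pos hr
    (measurable_regDiv hu 0).aestronglyMeasurable
  rw [eLpNorm', eLpNorm', div_one] at h
  refine le_trans (le_of_eq ?_) h
  simp only [ENNReal.rpow_one]
  rw [curvMeasure, levelMeasure, withDensity_apply _ MeasurableSet.univ, Measure.restrict_univ,
    lintegral_withDensity_eq_lintegral_mul _ hgm (measurable_regDiv hu 0).enorm]
  refine lintegral_congr fun x => ?_
  rw [ENNReal.ofReal_mul (norm_nonneg _), Pi.mul_apply, ← Real.norm_eq_abs, ofReal_norm (regDiv u 0 x)]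

/-- The measure `|H_v|^{pr} |∇v|^p dx` on the part of `Ω` where `∇v ≠ 0`. -/
noncomputable def curvEnergy {n : ℕ} (Ω : Set (EuclideanSpace ℝ (Fin n)))
    (v : EuclideanSpace ℝ (Fin n) → ℝ) (p r : ℝ) : Measure (EuclideanSpace ℝ (Fin n)) :=
  (volume.restrict (Ω ∩ {x | gradient v x ≠ 0})).withDensity fun x =>
    ENNReal.ofReal (|meanCurv v x| ^ (p * r) * ‖gradient v x‖ ^ p)

theorem lintegral_regDiv_levelCut_le {n : ℕ} (hn : 2 ≤ n) {Ω : Set (EuclideanSpace ℝ (Fin n))}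
    {v : EuclideanSpace ℝ (Fin n) → ℝ} {t : ℝ} (hΩ : IsOpen Ω)
    (hv : ContDiff ℝ (⊤ : ℕ∞) v) (hv0 : ∀ x ∈ frontier Ω, v x = 0) (ht : 0 < t) {D : ℝ}
    (hD0 : 0 < D) (hD : ∀ y, deriv Real.smoothTransition y ≤ D) {ε : ℝ} (hε : 0 < ε)
    {p q r : ℝ} (hpq : p.HolderConjugate q) (hr : 1 ≤ r)
    (hW : AEMeasurable (fun x => |meanCurv v x| ^ (p * r) * ‖gradient v x‖ ^ p)
      (volume.restrict (Ω ∩ {x | gradient v x ≠ 0}))) :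
    ∫⁻ x, ‖regDiv (levelCut Ω v t ε) 0 x‖ₑ ^ r ∂levelMeasure (levelCut Ω v t ε) ≤
      ENNReal.ofReal ((n - 1) ^ r * (D / ε)) *
        (curvEnergy Ω v p r {x | t < v x ∧ v x < t + ε} ^ (1 / p) *
          volume.restrict Ω {x | t < v x ∧ v x < t + ε} ^ (1 / q)) := by
  set u := levelCut Ω v t ε with hu
  have hn' : (2 : ℝ) ≤ n := by exact_mod_cast hn
  have hn1 : (0 : ℝ) ≤ n - 1 := by linarith
  have hus := contDiff_levelCut hΩ hv hv0 ht hε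
  have hvd : Differentiable ℝ v := hv.differentiable (by simp)
  have hsm : MeasurableSet {x | t < v x ∧ v x < t + ε} :=
    (measurableSet_lt measurable_const hv.continuous.measurable).inter
      (measurableSet_lt hv.continuous.measurable measurable_const)
  have hZm : MeasurableSet {x | gradient v x ≠ 0} :=
    (isClosed_eq hv.gradient'.continuous continuous_const).measurableSet.compl
  set S := {x | t < v x ∧ v x < t + ε} with hS
  set T := S ∩ (Ω ∩ {x | gradient v x ≠ 0}) with hT
  have hTm : MeasurableSet T := hsm.inter (hΩ.measurableSet.inter hZm)
  have hp := hpq.pos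
  have hgm : Measurable fun x => ENNReal.ofReal ‖gradient u x‖ :=
    hus.gradient'.continuous.norm.measurable.ennreal_ofReal
  set W : EuclideanSpace ℝ (Fin n) → ℝ :=
    fun x => |meanCurv v x| ^ (p * r) * ‖gradient v x‖ ^ p with hWdef
  have hWm : AEMeasurable (fun x => ENNReal.ofReal (W x) ^ (1 / p)) (volume.restrict T) :=
    (hW.mono_measure (Measure.restrict_mono Set.inter_subset_right le_rfl)).ennreal_ofReal.pow_const _
  have hroot : ∀ x, ENNReal.ofReal (W x) ^ (1 / p) =
      ENNReal.ofReal (|meanCurv v x| ^ r * ‖gradient v x‖) := by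
    intro x
    rw [ENNReal.ofReal_rpow_of_nonneg (by positivity) (by positivity)]
    congr 1
    rw [hWdef, Real.mul_rpow (by positivity) (by positivity), ← Real.rpow_mul (abs_nonneg _),
      ← Real.rpow_mul (norm_nonneg _), mul_one_div_cancel hp.ne', Real.rpow_one]
    congr 2
    field_simp
  have hpt : ∀ x, ENNReal.ofReal ‖gradient u x‖ * ‖regDiv u 0 x‖ₑ ^ r ≤
      T.indicator (fun x => ENNReal.ofReal ((n - 1) ^ r * (D / ε)) *
        ENNReal.ofReal (W x) ^ (1 / p)) x := by
    intro x
    by_cases hx : gradient u x = 0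
    · simp [hx]
    obtain ⟨h1, h2, h3, h4⟩ := gradient_ne_zero_of_levelCut hΩ hvd hv0 ht hε hx
    have hmem : x ∈ T := ⟨⟨h2, h3⟩, h1, h4⟩
    have hle := norm_gradient_levelCut_le hΩ hvd hv0 ht hε hD x
    have hmem2 : x ∈ Ω ∩ {x | t < v x ∧ v x < t + ε} := ⟨h1, h2, h3⟩
    rw [Set.indicator_of_mem hmem2] at hle
    rw [Set.indicator_of_mem hmem, hroot, ← ofReal_norm (regDiv u 0 x), Real.norm_eq_abs,
      abs_regDiv_levelCut hn hΩ hv hv0 ht hε hx, ENNReal.ofReal_rpow_of_nonneg (by positivity)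
      (by linarith), ← ENNReal.ofReal_mul (by positivity), ← ENNReal.ofReal_mul (by positivity)]
    refine ENNReal.ofReal_le_ofReal ?_
    rw [Real.mul_rpow hn1 (abs_nonneg _)]
    calc _ ≤ (D / ε * ‖gradient v x‖) * ((n - 1) ^ r * |meanCurv v x| ^ r) := by gcongr
      _ = _ := by ring
  calc _ = ∫⁻ x, ENNReal.ofReal ‖gradient u x‖ * ‖regDiv u 0 x‖ₑ ^ r :=
        lintegral_withDensity_eq_lintegral_mul _ hgm ((measurable_regDiv hus 0).enorm.pow_const r)
    _ ≤ ∫⁻ x, T.indicator (fun x => ENNReal.ofReal ((n - 1) ^ r * (D / ε)) *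
        ENNReal.ofReal (W x) ^ (1 / p)) x := lintegral_mono hpt
    _ = ENNReal.ofReal ((n - 1) ^ r * (D / ε)) * ∫⁻ x in T, ENNReal.ofReal (W x) ^ (1 / p) * 1 := by
        rw [lintegral_indicator hTm, lintegral_const_mul'' _ hWm]
        simp only [mul_one]
    _ ≤ _ := by
        gcongr
        refine (ENNReal.lintegral_mul_le_Lp_mul_Lq (volume.restrict T) hpq hWm
          aemeasurable_const).trans ?_
        gcongr
        · rw [curvEnergy, withDensity_apply _ hsm, Measure.restrict_restrict hsm]
          refine lintegral_mono fun x => ?_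
          rw [← ENNReal.rpow_mul, one_div_mul_cancel hp.ne', ENNReal.rpow_one]
        · exact one_div_nonneg.2 hpq.symm.pos.le
        · simp only [ENNReal.one_rpow, lintegral_const, one_mul, Measure.restrict_apply_univ]
          rw [Measure.restrict_apply hsm]
          exact measure_mono fun x hx => ⟨hx.1, hx.2.1⟩

theorem rpow_le_of_interpolation {P B Q K r μ : ℝ} (hP : 0 < P) (hQ : 0 ≤ Q)
    (hK : 0 ≤ K) (hr : 1 ≤ r) (hBQ : B ≤ Q ^ (1 / r) * P ^ (1 - 1 / r))
    (hPB : P ^ (1 - 1 / μ) ≤ K * B) : P ^ (1 - r / μ) ≤ K ^ r * Q := by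
  have hr0 : 0 < r := by linarith
  have h1 : P ^ (1 / r - 1 / μ) ≤ K * Q ^ (1 / r) := by
    have h2 : P ^ (1 / r - 1 / μ) * P ^ (1 - 1 / r) ≤ K * Q ^ (1 / r) * P ^ (1 - 1 / r) := by
      rw [← Real.rpow_add hP, show 1 / r - 1 / μ + (1 - 1 / r) = 1 - 1 / μ by ring, mul_assoc]
      exact hPB.trans (mul_le_mul_of_nonneg_left hBQ hK)
    exact le_of_mul_le_mul_right h2 (by positivity)
  have h3 := Real.rpow_le_rpow (by positivity) h1 hr0.le
  rw [Real.mul_rpow hK (by positivity), ← Real.rpow_mul hQ, ← Real.rpow_mul hP.le,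
    one_div_mul_cancel hr0.ne', Real.rpow_one] at h3
  convert h3 using 2
  field_simp

theorem levelMeasure_rpow_le {m n : ℕ} (hm : 2 ≤ m) (hn : n = m + 1)
    {u : EuclideanSpace ℝ (Fin n) → ℝ} (hu : ContDiff ℝ (⊤ : ℕ∞) u) (hc : HasCompactSupport u)
    {c : ℝ} (hc0 : 0 < c) (hP : 0 < (levelMeasure u).real Set.univ)
    (hG : (levelMeasure u).real Set.univ ≤
      2 * (levelMeasure u).real {x | ∃ ρ, 0 < ρ ∧
        c * ρ ^ m ≤ (levelMeasure u).real (Metric.closedBall x ρ)}) :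
    (levelMeasure u).real Set.univ ^ (1 - 1 / (m : ℝ)) ≤
      16 * 20 ^ m * c ^ (-(1 / (m : ℝ))) * (curvMeasure u).real Set.univ := by
  have := isFiniteMeasure_levelMeasure hu hc
  have := isFiniteMeasure_curvMeasure hu hc
  have hm0 : (m : ℝ) ≠ 0 := by positivity
  set P := (levelMeasure u).real Set.univ with hPdef
  set b := (curvMeasure u).real Set.univ with hb
  have hρ : 0 < (P / c) ^ (1 / (m : ℝ)) := by positivity
  have hPρ : P = c * ((P / c) ^ (1 / (m : ℝ))) ^ m := by
    rw [← Real.rpow_natCast, ← Real.rpow_mul (by positivity), one_div_mul_cancel hm0, Real.rpow_one]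
    field_simp
  have hd := measureReal_dense_le (σ := levelMeasure u) (β := curvMeasure u) hm
    (fun x₀ τ hτ => by
      refine ⟨x₀, ?_⟩
      exact Metric.ball_subset_interior_closedBall (Metric.mem_ball_self hτ))
    (fun x₀ s hs => levelMeasure_closedBall_le hm hn hu hc x₀ hs) hc0 hρ hPρ
  have h1 : P ≤ 16 * 20 ^ m * ((P / c) ^ (1 / (m : ℝ)) * b) := by linarith
  rw [Real.rpow_sub hP, Real.rpow_one, div_le_iff₀ (by positivity)]
  refine h1.trans (le_of_eq ?_)
  rw [Real.div_rpow hP.le hc0.le, Real.rpow_neg hc0.le]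
  ring

theorem measureReal_slab_le {E : Type*} [MeasurableSpace E] (μ : Measure E) [IsFiniteMeasure μ]
    {v : E → ℝ} (hv : Measurable v) (t : ℝ) {ε : ℝ} (hε : 0 < ε) :
    μ.real {x | t < v x ∧ v x < t + ε} ≤ μ.real {x | t < v x} - μ.real {x | t + ε < v x} := by
  have hm : MeasurableSet {x | t + ε < v x} := measurableSet_lt measurable_const hv
  rw [le_sub_iff_add_le, ← measureReal_union _ hm]
  · refine measureReal_mono ?_
    rintro x (hx | hx)
    · exact hx.1
    · have : t + ε < v x := hx
      show t < v x
      linarith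
  · rw [Set.disjoint_left]
    intro x hx (hx' : t + ε < v x)
    exact lt_asymm hx.2 hx'

theorem isFiniteMeasure_curvEnergy {n : ℕ} {Ω : Set (EuclideanSpace ℝ (Fin n))}
    {v : EuclideanSpace ℝ (Fin n) → ℝ} {p r : ℝ}
    (hW : IntegrableOn (fun x => |meanCurv v x| ^ (p * r) * ‖gradient v x‖ ^ p)
      (Ω ∩ {x | gradient v x ≠ 0})) : IsFiniteMeasure (curvEnergy Ω v p r) :=
  isFiniteMeasure_withDensity_ofReal hW.2

theorem exists_tail_inequality {m n : ℕ} (hm : 2 ≤ m) (hn : n = m + 1) {p q r : ℝ}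
    (hpq : p.HolderConjugate q) (hr : 1 ≤ r) (hnpr : (n : ℝ) = p * (1 + r)) :
    ∃ C : ℝ, 0 < C ∧ ∀ (Ω : Set (EuclideanSpace ℝ (Fin n))), IsOpen Ω → IsBounded Ω →
      ∀ v : EuclideanSpace ℝ (Fin n) → ℝ, ContDiff ℝ (⊤ : ℕ∞) v →
      (∀ x ∈ frontier Ω, v x = 0) →
      IntegrableOn (fun x => |meanCurv v x| ^ (p * r) * ‖gradient v x‖ ^ p)
        (Ω ∩ {x | gradient v x ≠ 0}) →
      ∀ V A : ℝ → ℝ, (∀ s, V s = (volume.restrict Ω).real {x | s < v x}) →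
      (∀ s, A s = (curvEnergy Ω v p r).real {x | s < v x}) →
      ∀ t, 0 < t → 0 < V t →
      ∀ Q, (∀ᶠ ε in 𝓝[>] (0 : ℝ), (V t - V (t + ε)) / ε ≤ Q) →
      ∀ᶠ ε in 𝓝[>] (0 : ℝ), V (t + ε) ^ (1 / q) ≤
        C * (((A t - A (t + ε)) / ε) ^ (1 / p) * ((V t - V (t + ε)) / ε) ^ (1 / q)) := by
  have hm1 : 1 ≤ m := by omega
  have hm0 : (0 : ℝ) < m := by positivity
  have hn0 : (0 : ℝ) < n := by rw [hn]; positivity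
  have hp := hpq.pos
  have hq := hpq.symm.pos
  have hn1 : (0 : ℝ) < n - 1 := by rw [hn]; push_cast; linarith
  obtain ⟨C₀, hC₀, hiso⟩ := exists_isoperimetric_const m hm1 hn
  obtain ⟨D, hD0, hD⟩ := exists_deriv_smoothTransition_le
  set c := volume.real (Metric.ball (0 : EuclideanSpace ℝ (Fin n)) 1) / 4 ^ n with hc
  have hc0 : 0 < c := by
    refine div_pos ?_ (by positivity)
    exact ENNReal.toReal_pos (Metric.measure_ball_pos _ _ one_pos).ne' measure_ball_lt_top.ne
  set K := 16 * 20 ^ m * c ^ (-(1 / (m : ℝ))) with hK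
  have hK0 : 0 < K := by positivity
  refine ⟨C₀ ^ (1 / q) * (K ^ r * ((n - 1) ^ r * D)), by positivity, ?_⟩
  intro Ω hΩ hΩb v hv hv0 hW V A hV hA t ht hVt Q hQ
  have : IsFiniteMeasure (volume.restrict Ω) :=
    ⟨by simpa using hΩb.measure_lt_top⟩
  have := isFiniteMeasure_curvEnergy hW
  have hvm := hv.continuous.measurable
  set Q₁ := max Q 1 with hQ₁
  have hQ₁0 : 0 < Q₁ := lt_max_of_lt_right one_pos
  set P₀ := (V t / (2 * C₀)) ^ ((m : ℝ) / n) with hP₀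
  have hP₀0 : 0 < P₀ := by positivity
  set γ := P₀ / (2 * D * Q₁) with hγ
  have hγ0 : 0 < γ := by positivity
  obtain ⟨ε₀, hε₀, hdens⟩ := exists_density_levelCut hn hΩ hΩb hv hv0 ht hγ0
  have hsmall : ∀ᶠ ε in 𝓝[>] (0 : ℝ), ε < min ε₀ (V t / (2 * Q₁)) :=
    (eventually_lt_nhds (by positivity)).filter_mono nhdsWithin_le_nhds
  filter_upwards [hQ, hsmall, self_mem_nhdsWithin] with ε hεQ hεs hε
  have hε : 0 < ε := hε
  have hε₁ : ε ≤ ε₀ := (hεs.trans_le (min_le_left _ _)).le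
  have hε₂ : ε ≤ V t / (2 * Q₁) := (hεs.trans_le (min_le_right _ _)).le
  set S := {x | t < v x ∧ v x < t + ε} with hS
  have hVs : (volume.restrict Ω).real S ≤ V t - V (t + ε) := by
    rw [hV, hV]; exact measureReal_slab_le _ hvm t hε
  have hAs : (curvEnergy Ω v p r).real S ≤ A t - A (t + ε) := by
    rw [hA, hA]; exact measureReal_slab_le _ hvm t hε
  have hVQ : V t - V (t + ε) ≤ Q₁ * ε := by
    rw [← div_le_iff₀ hε]; exact hεQ.trans (le_max_left _ _)
  have hVhalf : V t / 2 ≤ V (t + ε) := by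
    have : Q₁ * ε ≤ V t / 2 := by
      calc Q₁ * ε ≤ Q₁ * (V t / (2 * Q₁)) := by gcongr
        _ = V t / 2 := by field_simp
    linarith
  set u := levelCut Ω v t ε with hu
  have hus := contDiff_levelCut hΩ hv hv0 ht hε
  have huc : HasCompactSupport u := hasCompactSupport_levelCut hΩb hv.continuous hε
  have := isFiniteMeasure_levelMeasure hus huc
  have := isFiniteMeasure_curvMeasure hus huc
  set P := (levelMeasure u).real Set.univ with hP
  have hisoV : V (t + ε) ≤ C₀ * P ^ ((n : ℝ) / m) := by
    have h := hiso u hus huc (Ω ∩ {x | t + ε < v x}) fun x hx => by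
      rw [hu, levelCut, Set.indicator_of_mem hx.1]
      refine Real.smoothTransition.one_of_one_le ?_
      rw [one_le_div hε]
      have : t + ε < v x := hx.2
      linarith
    rw [hV, measureReal_restrict_apply (measurableSet_lt measurable_const hvm), Set.inter_comm]
    exact h
  have hPP₀ : P₀ ≤ P := by
    have h1 : V t / (2 * C₀) ≤ P ^ ((n : ℝ) / m) := by
      rw [div_le_iff₀ (by positivity)]
      linarith
    calc P₀ ≤ (P ^ ((n : ℝ) / m)) ^ ((m : ℝ) / n) := by
          rw [hP₀]; gcongr
      _ = P := by
          rw [← Real.rpow_mul measureReal_nonneg, div_mul_div_cancel₀ hm0.ne', div_self hn0.ne',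
            Real.rpow_one]
  have hP0 : 0 < P := hP₀0.trans_le hPP₀
  have hhalf := levelMeasure_levelCut_univ_le hΩ hΩb hv hv0 ht hD0 hD hε hγ0
    (G := {x | ∃ ρ, 0 < ρ ∧ c * ρ ^ m ≤ (levelMeasure u).real (Metric.closedBall x ρ)})
    (fun x hx h1 h2 h3 => hdens ε hε hε₁ x hx h1 h2 h3)
  have hbad : D / ε * γ * (volume.restrict Ω).real S ≤ P / 2 := by
    calc D / ε * γ * (volume.restrict Ω).real S ≤ D / ε * γ * (Q₁ * ε) := by
          gcongr; exact hVs.trans hVQ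
      _ = P₀ / 2 := by rw [hγ]; field_simp
      _ ≤ P / 2 := by linarith
  have hPb : P ^ (1 - 1 / (m : ℝ)) ≤ K * (curvMeasure u).real Set.univ :=
    levelMeasure_rpow_le hm hn hus huc hc0 hP0 (by
      have h := hhalf
      rw [← hu, ← hP] at h
      have h2 : P ≤ (levelMeasure u).real {x | ∃ ρ, 0 < ρ ∧
        c * ρ ^ m ≤ (levelMeasure u).real (Metric.closedBall x ρ)} + P / 2 := h.trans (by gcongr)
      linarith)
  set Z := (n - 1) ^ r * (D / ε) * ((curvEnergy Ω v p r).real S ^ (1 / p) *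
    (volume.restrict Ω).real S ^ (1 / q)) with hZ
  have hZ0 : 0 ≤ Z := by positivity
  have hBQ : (curvMeasure u).real Set.univ ≤ Z ^ (1 / r) * P ^ (1 - 1 / r) := by
    have h1 := (curvMeasure_univ_le hus hr).trans (mul_le_mul_left (ENNReal.rpow_le_rpow
      (lintegral_regDiv_levelCut_le (by omega) hΩ hv hv0 ht hD0 hD hε hpq hr
        hW.aestronglyMeasurable.aemeasurable) (by positivity)) _)
    have h1r : 0 ≤ 1 - 1 / r := by
      rw [sub_nonneg, div_le_one (by linarith)]; exact hr
    have h2 := ENNReal.toReal_mono (by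
      refine ENNReal.mul_ne_top (ENNReal.rpow_ne_top_of_nonneg (by positivity) ?_)
        (ENNReal.rpow_ne_top_of_nonneg h1r (measure_ne_top _ _))
      refine ENNReal.mul_ne_top ENNReal.ofReal_ne_top (ENNReal.mul_ne_top ?_ ?_)
      · exact ENNReal.rpow_ne_top_of_nonneg (by positivity) (measure_ne_top _ _)
      · exact ENNReal.rpow_ne_top_of_nonneg (by positivity) (measure_ne_top _ _)) h1
    rw [ENNReal.toReal_mul, ← ENNReal.toReal_rpow, ← ENNReal.toReal_rpow, ENNReal.toReal_mul,
      ENNReal.toReal_mul, ENNReal.toReal_ofReal (by positivity), ← ENNReal.toReal_rpow,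
      ← ENNReal.toReal_rpow] at h2
    exact h2
  have hfin := rpow_le_of_interpolation hP0 hZ0 hK0.le hr hBQ hPb
  have hexp : (n : ℝ) / m * (1 / q) = 1 - r / m := by
    have hmn : (n : ℝ) = m + 1 := by rw [hn]; push_cast; ring
    have h1 := hpq.inv_add_inv_eq_one
    have h2 : 1 / q = 1 - p⁻¹ := by rw [one_div]; linarith
    rw [h2]
    have hmr : (m : ℝ) = p * (1 + r) - 1 := by linarith
    have hm00 := hm0.ne'
    rw [hnpr]
    field_simp
    linear_combination -hmr
  calc V (t + ε) ^ (1 / q) ≤ (C₀ * P ^ ((n : ℝ) / m)) ^ (1 / q) := by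
        gcongr
        linarith
    _ = C₀ ^ (1 / q) * P ^ (1 - r / (m : ℝ)) := by
        rw [Real.mul_rpow hC₀.le (by positivity), ← Real.rpow_mul hP0.le, hexp]
    _ ≤ C₀ ^ (1 / q) * (K ^ r * Z) := by gcongr
    _ ≤ C₀ ^ (1 / q) * (K ^ r * ((n - 1) ^ r * (D / ε) * ((A t - A (t + ε)) ^ (1 / p) *
          (V t - V (t + ε)) ^ (1 / q)))) := by
        rw [hZ]
        gcongr
        exact Real.rpow_nonneg (measureReal_nonneg.trans hAs) _
    _ = _ := by
        rw [Real.div_rpow (measureReal_nonneg.trans hAs) hε.le,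
          Real.div_rpow (measureReal_nonneg.trans hVs) hε.le]
        have h3 : ε ^ (1 / p) * ε ^ (1 / q) = ε := by
          rw [← Real.rpow_add hε, one_div, one_div, hpq.inv_add_inv_eq_one, Real.rpow_one]
        have h4 : D / ε = D * ((ε ^ (1 / p))⁻¹ * (ε ^ (1 / q))⁻¹) := by
          rw [← mul_inv, h3, div_eq_mul_inv]
        rw [h4]
        ring

theorem Monotone.lintegral_ofReal_deriv_le {f : ℝ → ℝ} (hf : Monotone f) {T : ℝ} (hT : 0 ≤ T) :
    ∫⁻ x in Set.Ioc 0 T, ENNReal.ofReal (deriv f x) ≤ ENNReal.ofReal (f T - f 0) := by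
  have hfT : MonotoneOn f (Set.uIcc 0 T) := hf.monotoneOn _
  have hint := hfT.intervalIntegrable_deriv
  rw [intervalIntegrable_iff_integrableOn_Ioc_of_le hT] at hint
  rw [← ofReal_integral_eq_lintegral_ofReal hint (ae_of_all _ fun x => hf.deriv_nonneg)]
  refine ENNReal.ofReal_le_ofReal ?_
  have h := hfT.intervalIntegral_deriv_mem_uIcc
  rw [intervalIntegral.integral_of_le hT, Set.uIcc_of_le (sub_nonneg.2 (hf hT))] at h
  exact h.2

theorem tendsto_neg_deriv_of_differentiableAt {f : ℝ → ℝ} {t : ℝ} (hf : DifferentiableAt ℝ f t) :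
    Tendsto (fun ε => (f t - f (t + ε)) / ε) (𝓝[>] 0) (𝓝 (-deriv f t)) := by
  have h := (hasDerivAt_iff_tendsto_slope_zero.1 hf.hasDerivAt).mono_left
    (nhdsGT_le_nhdsNE (0 : ℝ))
  refine h.neg.congr fun ε => ?_
  rw [smul_eq_mul]
  ring

theorem le_of_tail_inequality {V A : ℝ → ℝ} (hV : Antitone V) (hA : Antitone A) {C p q : ℝ}
    (hC : 0 < C) (hpq : p.HolderConjugate q) (hA0 : ∀ s, 0 ≤ A s)
    (h : ∀ t, 0 < t → 0 < V t → ∀ Q, (∀ᶠ ε in 𝓝[>] (0 : ℝ), (V t - V (t + ε)) / ε ≤ Q) →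
      ∀ᶠ ε in 𝓝[>] (0 : ℝ), V (t + ε) ^ (1 / q) ≤
        C * (((A t - A (t + ε)) / ε) ^ (1 / p) * ((V t - V (t + ε)) / ε) ^ (1 / q)))
    {T : ℝ} (hT : 0 < T) (hVT : 0 < V T) :
    T ≤ C * (A 0 ^ (1 / p) * Real.log (V 0 / V T) ^ (1 / q)) := by
  have hp := hpq.pos
  have hq := hpq.symm.pos
  have hp' : 0 ≤ 1 / p := one_div_nonneg.2 hp.le
  have hq' : 0 ≤ 1 / q := one_div_nonneg.2 hq.le
  have hV0 : 0 < V 0 := hVT.trans_le (hV hT.le)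
  set f : ℝ → ℝ := fun s => -A s with hf
  set g : ℝ → ℝ := fun s => -Real.log (max (V s) (V T)) with hg
  have hfm : Monotone f := fun a b hab => neg_le_neg (hA hab)
  have hgm : Monotone g := fun a b hab => neg_le_neg
    (Real.log_le_log (lt_max_of_lt_right hVT) (max_le_max (hV hab) le_rfl))
  have hpt : ∀ᵐ t ∂volume.restrict (Set.Ioc 0 T), (1 : ℝ≥0∞) ≤ ENNReal.ofReal C *
      (ENNReal.ofReal (deriv f t) ^ (1 / p) * ENNReal.ofReal (deriv g t) ^ (1 / q)) := by
    rw [ae_restrict_iff' measurableSet_Ioc]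
    have hne : ∀ᵐ t : ℝ, t ≠ T := by simp [ae_iff, measure_singleton]
    filter_upwards [hfm.ae_differentiableAt, hV.neg.ae_differentiableAt, hne] with t hft hVt htT ht
    have htT : t < T := lt_of_le_of_ne ht.2 htT
    have hVt0 : 0 < V t := hVT.trans_le (hV htT.le)
    have hAt : DifferentiableAt ℝ A t := by simpa [hf] using hft
    have hVt : DifferentiableAt ℝ V t := by simpa using hVt.neg
    have hAlim := tendsto_neg_deriv_of_differentiableAt hAt
    have hVlim := tendsto_neg_deriv_of_differentiableAt hVt
    have hev := h t ht.1 hVt0 (-deriv V t + 1)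
      ((hVlim.eventually_le_const (by linarith)))
    have hshift : Tendsto (fun ε => V (t + ε)) (𝓝[>] (0 : ℝ)) (𝓝 (V t)) := by
      have h1 : ContinuousAt (fun ε => V (t + ε)) 0 :=
        ContinuousAt.comp (by simpa using hVt.continuousAt) (by fun_prop)
      simpa using h1.tendsto.mono_left nhdsWithin_le_nhds
    have hle := le_of_tendsto_of_tendsto (hshift.rpow_const (p := 1 / q) (Or.inl hVt0.ne'))
      (((hAlim.rpow_const (p := 1 / p) (Or.inr hp')).mul
        (hVlim.rpow_const (p := 1 / q) (Or.inr hq'))).const_mul C) hev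
    have hf' : deriv f t = -deriv A t := by rw [hf, deriv.fun_neg]
    have hg' : deriv g t = -deriv V t / V t := by
      have : g =ᶠ[𝓝 t] fun s => -Real.log (V s) := by
        filter_upwards [eventually_lt_nhds htT] with s hs
        simp only [hg, max_eq_left (hV hs.le)]
      rw [this.deriv_eq, deriv.fun_neg, deriv.log hVt hVt0.ne', neg_div]
    have hA' : 0 ≤ deriv f t := hfm.deriv_nonneg
    have hg'' : 0 ≤ deriv g t := hgm.deriv_nonneg
    have hV' : -deriv V t = deriv g t * V t := by rw [hg']; field_simp
    rw [← hf', hV', Real.mul_rpow hg'' hVt0.le] at hle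
    have h1 : 1 ≤ C * (deriv f t ^ (1 / p) * deriv g t ^ (1 / q)) := by
      have : 0 < V t ^ (1 / q) := by positivity
      refine le_of_mul_le_mul_right ?_ this
      linarith
    rw [ENNReal.ofReal_rpow_of_nonneg hA' hp', ENNReal.ofReal_rpow_of_nonneg hg'' hq',
      ← ENNReal.ofReal_mul (by positivity), ← ENNReal.ofReal_mul hC.le]
    exact ENNReal.one_le_ofReal.2 h1
  have hmf : Measurable fun t => ENNReal.ofReal (deriv f t) ^ (1 / p) :=
    (measurable_deriv f).ennreal_ofReal.pow_const _
  have hmg : Measurable fun t => ENNReal.ofReal (deriv g t) ^ (1 / q) :=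
    (measurable_deriv g).ennreal_ofReal.pow_const _
  have hgT : g T - g 0 = Real.log (V 0 / V T) := by
    simp only [hg, max_self, max_eq_left (hV hT.le)]
    rw [Real.log_div hV0.ne' hVT.ne']
    ring
  have hlog : 0 ≤ Real.log (V 0 / V T) := by
    rw [← hgT]; exact sub_nonneg.2 (hgm hT.le)
  have hAf : f T - f 0 ≤ A 0 := by
    have := hA0 T
    simp only [hf]
    linarith
  have hfin : ENNReal.ofReal T ≤ ENNReal.ofReal
      (C * (A 0 ^ (1 / p) * Real.log (V 0 / V T) ^ (1 / q))) := by
    calc ENNReal.ofReal T = ∫⁻ _ in Set.Ioc 0 T, 1 := by simp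
      _ ≤ ∫⁻ t in Set.Ioc 0 T, ENNReal.ofReal C *
          (ENNReal.ofReal (deriv f t) ^ (1 / p) * ENNReal.ofReal (deriv g t) ^ (1 / q)) :=
        lintegral_mono_ae hpt
      _ = ENNReal.ofReal C * ∫⁻ t in Set.Ioc 0 T,
          ENNReal.ofReal (deriv f t) ^ (1 / p) * ENNReal.ofReal (deriv g t) ^ (1 / q) :=
        lintegral_const_mul _ (hmf.mul hmg)
      _ ≤ ENNReal.ofReal C * (ENNReal.ofReal (A 0) ^ (1 / p) *
          ENNReal.ofReal (Real.log (V 0 / V T)) ^ (1 / q)) := by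
        gcongr
        refine (ENNReal.lintegral_mul_le_Lp_mul_Lq _ hpq hmf.aemeasurable
          hmg.aemeasurable).trans ?_
        simp only [← ENNReal.rpow_mul, one_div_mul_cancel hp.ne', one_div_mul_cancel hq.ne',
          ENNReal.rpow_one]
        gcongr
        · exact (hfm.lintegral_ofReal_deriv_le hT.le).trans (ENNReal.ofReal_le_ofReal hAf)
        · exact (hgm.lintegral_ofReal_deriv_le hT.le).trans (by rw [hgT])
      _ = _ := by
        rw [ENNReal.ofReal_rpow_of_nonneg (hA0 0) hp', ENNReal.ofReal_rpow_of_nonneg hlog hq',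
          ← ENNReal.ofReal_mul (Real.rpow_nonneg (hA0 0) _), ← ENNReal.ofReal_mul hC.le]
  have hR0 : 0 ≤ C * (A 0 ^ (1 / p) * Real.log (V 0 / V T) ^ (1 / q)) :=
    mul_nonneg hC.le (mul_nonneg (Real.rpow_nonneg (hA0 0) _) (Real.rpow_nonneg hlog _))
  exact (ENNReal.ofReal_le_ofReal_iff hR0).1 hfin

theorem exists_superlevel_decay {m n : ℕ} (hm : 2 ≤ m) (hn : n = m + 1) {p q r : ℝ}
    (hpq : p.HolderConjugate q) (hr : 1 ≤ r) (hnpr : (n : ℝ) = p * (1 + r)) :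
    ∃ C : ℝ, 0 < C ∧ ∀ (Ω : Set (EuclideanSpace ℝ (Fin n))), IsOpen Ω → IsBounded Ω →
      ∀ v : EuclideanSpace ℝ (Fin n) → ℝ, ContDiff ℝ (⊤ : ℕ∞) v →
      (∀ x ∈ frontier Ω, v x = 0) →
      IntegrableOn (fun x => |meanCurv v x| ^ (p * r) * ‖gradient v x‖ ^ p)
        (Ω ∩ {x | gradient v x ≠ 0}) →
      ∀ I : ℝ, I = (∫ x in Ω ∩ {x | gradient v x ≠ 0},
          |meanCurv v x| ^ (p * r) * ‖gradient v x‖ ^ p) ^ (1 / p) → 0 < I →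
      ∀ T, 0 < T → (volume.restrict Ω).real {x | T < v x} ≤
        volume.real Ω * Real.exp (-(T / (C * I)) ^ q) := by
  obtain ⟨C, hC, h⟩ := exists_tail_inequality hm hn hpq hr hnpr
  refine ⟨C, hC, ?_⟩
  intro Ω hΩ hΩb v hv hv0 hW I hI hI0 T hT
  have hp := hpq.pos
  have hq := hpq.symm.pos
  have : IsFiniteMeasure (volume.restrict Ω) := ⟨by simpa using hΩb.measure_lt_top⟩
  have := isFiniteMeasure_curvEnergy hW
  set V : ℝ → ℝ := fun s => (volume.restrict Ω).real {x | s < v x} with hV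
  set A : ℝ → ℝ := fun s => (curvEnergy Ω v p r).real {x | s < v x} with hA
  have hVa : Antitone V := fun a b hab =>
    measureReal_mono fun x (hx : b < v x) => lt_of_le_of_lt hab hx
  have hAa : Antitone A := fun a b hab =>
    measureReal_mono fun x (hx : b < v x) => lt_of_le_of_lt hab hx
  have hV0M : V 0 ≤ volume.real Ω := by
    rw [← measureReal_restrict_apply_univ]
    exact measureReal_mono (Set.subset_univ _)
  rcases (show 0 ≤ V T from measureReal_nonneg).eq_or_lt with hVT | hVT
  · change V T ≤ _
    rw [← hVT]
    positivity
  have hmain := le_of_tail_inequality hVa hAa hC hpq (fun _ => measureReal_nonneg)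
    (h Ω hΩ hΩb v hv hv0 hW V A (fun _ => rfl) (fun _ => rfl)) hT hVT
  have hV00 : 0 < V 0 := hVT.trans_le (hVa hT.le)
  have hA0 : A 0 ^ (1 / p) ≤ I := by
    rw [hI]
    refine Real.rpow_le_rpow measureReal_nonneg ?_ (one_div_nonneg.2 hp.le)
    refine (measureReal_mono (Set.subset_univ _)).trans (le_of_eq ?_)
    rw [Measure.real, curvEnergy, withDensity_apply _ MeasurableSet.univ, Measure.restrict_univ,
      ← ofReal_integral_eq_lintegral_ofReal hW (ae_of_all _ fun x => by positivity),
      ENNReal.toReal_ofReal (integral_nonneg fun x => by positivity)]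
  have hlog : 0 ≤ Real.log (V 0 / V T) := by
    refine Real.log_nonneg ?_
    rw [one_le_div hVT]
    exact hVa hT.le
  have h1 : T / (C * I) ≤ Real.log (V 0 / V T) ^ (1 / q) := by
    rw [div_le_iff₀ (by positivity)]
    calc T ≤ C * (A 0 ^ (1 / p) * Real.log (V 0 / V T) ^ (1 / q)) := hmain
      _ ≤ C * (I * Real.log (V 0 / V T) ^ (1 / q)) := by gcongr
      _ = _ := by ring
  have h2 : (T / (C * I)) ^ q ≤ Real.log (V 0 / V T) := by
    refine (Real.rpow_le_rpow (by positivity) h1 hq.le).trans (le_of_eq ?_)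
    rw [← Real.rpow_mul hlog, one_div_mul_cancel hq.ne', Real.rpow_one]
  have h3 : Real.exp ((T / (C * I)) ^ q) ≤ V 0 / V T :=
    (Real.exp_le_exp.2 h2).trans_eq (Real.exp_log (by positivity))
  change V T ≤ _
  rw [Real.exp_neg, ← div_eq_mul_inv, le_div_iff₀ (Real.exp_pos _)]
  rw [le_div_iff₀ hVT] at h3
  linarith

theorem gradient_fun_neg {n : ℕ} (v : EuclideanSpace ℝ (Fin n) → ℝ)
    (x : EuclideanSpace ℝ (Fin n)) : gradient (fun y => -v y) x = -gradient v x := by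
  rw [gradient, gradient, fderiv_fun_neg, map_neg]

theorem meanCurv_fun_neg {n : ℕ} (v : EuclideanSpace ℝ (Fin n) → ℝ)
    (x : EuclideanSpace ℝ (Fin n)) : meanCurv (fun y => -v y) x = -meanCurv v x := by
  have h : (fun y => ‖gradient (fun y => -v y) y‖⁻¹ • gradient (fun y => -v y) y) =
      fun y => -(‖gradient v y‖⁻¹ • gradient v y) := by
    funext y
    rw [gradient_fun_neg, norm_neg, smul_neg]
  rw [meanCurv, meanCurv, h, divg, divg, fderiv_fun_neg]
  simp

theorem integral_exp_rpow_le {E : Type*} [MeasurableSpace E] {μ : Measure E} [IsFiniteMeasure μ]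
    {F : E → ℝ} (hF : Measurable F) (hF0 : ∀ x, 0 ≤ F x) {a q M : ℝ} (ha : 0 < a) (hq : 0 < q)
    (hM : 0 ≤ M) (hμ : μ.real Set.univ ≤ M)
    (h : ∀ T, 0 < T → μ.real {x | T < F x} ≤ 2 * (M * Real.exp (-(T / a) ^ q))) :
    ∫ x, Real.exp ((F x / (2 ^ (1 / q) * a)) ^ q) ∂μ ≤ 3 * M := by
  set b := 2 ^ (1 / q) * a with hb
  have hb0 : 0 < b := by positivity
  set X : E → ℝ := fun x => (F x / b) ^ q with hX
  have hXm : Measurable X := (hF.div_const b).pow_const q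
  have hX0 : ∀ x, 0 ≤ X x := fun x => Real.rpow_nonneg (div_nonneg (hF0 x) hb0.le) _
  have htail : ∀ s, 0 < s → μ {x | s < X x} * ENNReal.ofReal (Real.exp s) ≤
      ENNReal.ofReal (2 * M * Real.exp (-s)) := by
    intro s hs
    have hsub : {x | s < X x} ⊆ {x | b * s ^ (1 / q) < F x} := by
      intro x (hx : s < (F x / b) ^ q)
      have h1 := Real.rpow_lt_rpow hs.le hx (one_div_pos.2 hq)
      rw [← Real.rpow_mul (div_nonneg (hF0 x) hb0.le), mul_one_div_cancel hq.ne', Real.rpow_one,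
        lt_div_iff₀ hb0] at h1
      show b * s ^ (1 / q) < F x
      linarith
    have h2 : μ.real {x | s < X x} ≤ 2 * (M * Real.exp (-(2 * s))) := by
      refine (measureReal_mono hsub).trans ((h _ (by positivity)).trans (le_of_eq ?_))
      rw [show b * s ^ (1 / q) / a = (2 * s) ^ (1 / q) by
        rw [hb, Real.mul_rpow two_pos.le hs.le]; field_simp, ← Real.rpow_mul (by positivity),
        one_div_mul_cancel hq.ne', Real.rpow_one]
    rw [← ofReal_measureReal, ← ENNReal.ofReal_mul measureReal_nonneg]
    refine ENNReal.ofReal_le_ofReal ?_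
    calc μ.real {x | s < X x} * Real.exp s ≤ 2 * (M * Real.exp (-(2 * s))) * Real.exp s := by
          gcongr
      _ = 2 * M * (Real.exp (-(2 * s)) * Real.exp s) := by ring
      _ = _ := by rw [← Real.exp_add]; congr 2; ring
  have hlc : ∫⁻ x, ENNReal.ofReal (Real.exp (X x) - 1) ∂μ ≤ ENNReal.ofReal (2 * M) := by
    have h1 := lintegral_comp_eq_lintegral_meas_lt_mul (g := Real.exp) μ (ae_of_all _ hX0)
      hXm.aemeasurable (fun t _ => Real.continuous_exp.intervalIntegrable 0 t)
      (ae_of_all _ fun t => (Real.exp_pos t).le)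
    simp only [integral_exp, Real.exp_zero] at h1
    rw [h1]
    calc _ ≤ ∫⁻ s in Set.Ioi 0, ENNReal.ofReal (2 * M * Real.exp (-s)) :=
          setLIntegral_mono' measurableSet_Ioi htail
      _ = ENNReal.ofReal (2 * M) := by
          rw [← ofReal_integral_eq_lintegral_ofReal ((integrableOn_exp_neg_Ioi 0).const_mul _)
            (ae_of_all _ fun s => by positivity), integral_const_mul, integral_exp_neg_Ioi_zero,
            mul_one]
  rw [integral_eq_lintegral_of_nonneg_ae (ae_of_all _ fun x => (Real.exp_pos _).le)
    hXm.exp.aestronglyMeasurable]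
  refine ENNReal.toReal_le_of_le_ofReal (by positivity) ?_
  calc ∫⁻ x, ENNReal.ofReal (Real.exp (X x)) ∂μ
      = ∫⁻ x, (ENNReal.ofReal (Real.exp (X x) - 1) + 1) ∂μ := by
        refine lintegral_congr fun x => ?_
        rw [← ENNReal.ofReal_one, ← ENNReal.ofReal_add
          (sub_nonneg.2 (Real.one_le_exp (hX0 x))) zero_le_one, sub_add_cancel]
    _ = ∫⁻ x, ENNReal.ofReal (Real.exp (X x) - 1) ∂μ + μ Set.univ := by
        rw [lintegral_add_right _ measurable_const, lintegral_const, one_mul]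
    _ ≤ ENNReal.ofReal (2 * M) + ENNReal.ofReal M := by
        gcongr
        rw [← ofReal_measureReal]
        exact ENNReal.ofReal_le_ofReal hμ
    _ = ENNReal.ofReal (3 * M) := by
        rw [← ENNReal.ofReal_add (by positivity) hM]; congr 1; ring

/-- Trudinger-type geometric inequality (Theorem 1.1(c)): if `p > 1`, `r ≥ 1`, `n = p(1+r)`,
then `∫_Ω exp((|v|/(C₃ I_p))^{p'}) dx ≤ C₄ |Ω|` where
`I_p = (∫_{Ω∩{|∇v|>0}} |H_v|^{pr} |∇v|^p dx)^{1/p}` and `p' = p/(p-1)`. -/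
theorem stmt_2 (n : ℕ) (hn : 2 ≤ n) (p r : ℝ) (hp : 1 < p) (hr : 1 ≤ r)
    (hnpr : (n : ℝ) = p * (1 + r)) :
    ∃ C₃ C₄ : ℝ, 0 < C₃ ∧ 0 < C₄ ∧
      ∀ (Ω : Set (EuclideanSpace ℝ (Fin n))), IsOpen Ω → IsBounded Ω →
        ∀ v : EuclideanSpace ℝ (Fin n) → ℝ, ContDiff ℝ (⊤ : ℕ∞) v →
          (∀ x ∈ frontier Ω, v x = 0) →
          ∀ Ip : ℝ,
            Ip = (∫ x in Ω ∩ {x | gradient v x ≠ 0},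
                |meanCurv v x| ^ (p * r) * ‖gradient v x‖ ^ p) ^ (1 / p) →
            0 < Ip →
            ∫ x in Ω, Real.exp ((|v x| / (C₃ * Ip)) ^ (p / (p - 1))) ≤
              C₄ * (volume Ω).toReal := by
  have hpq : p.HolderConjugate (p / (p - 1)) := Real.HolderConjugate.conjExponent hp
  have hn3 : 2 < n := by
    have : (2 : ℝ) < n := by nlinarith
    exact_mod_cast this
  obtain ⟨m, rfl⟩ : ∃ m, n = m + 1 := ⟨n - 1, by omega⟩
  set q := p / (p - 1) with hqdef
  have hq := hpq.symm.pos
  obtain ⟨C, hC, h⟩ := exists_superlevel_decay (m := m) (by omega) rfl hpq hr hnpr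
  refine ⟨2 ^ (1 / q) * C, 3, by positivity, by norm_num, ?_⟩
  intro Ω hΩ hΩb v hv hv0 I hI hI0
  have : IsFiniteMeasure (volume.restrict Ω) := ⟨by simpa using hΩb.measure_lt_top⟩
  have hW : IntegrableOn (fun x => |meanCurv v x| ^ (p * r) * ‖gradient v x‖ ^ p)
      (Ω ∩ {x | gradient v x ≠ 0}) := by
    by_contra hcon
    rw [integral_undef hcon, Real.zero_rpow (one_div_pos.2 hpq.pos).ne'] at hI
    exact hI0.ne' hI
  have hneg : ∀ T, 0 < T → (volume.restrict Ω).real {x | T < -v x} ≤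
      volume.real Ω * Real.exp (-(T / (C * I)) ^ q) := by
    have h' := h Ω hΩ hΩb (fun x => -v x) hv.neg (fun x hx => by simp [hv0 x hx])
    simp only [gradient_fun_neg, meanCurv_fun_neg, abs_neg, norm_neg, ne_eq, neg_eq_zero] at h'
    exact h' hW I hI hI0
  rw [mul_assoc]
  refine integral_exp_rpow_le hv.continuous.measurable.abs (fun x => abs_nonneg _)
    (mul_pos hC hI0) hq ENNReal.toReal_nonneg (measureReal_restrict_apply_univ _).le fun T hT => ?_
  have hun : {x | T < |v x|} = {x | T < v x} ∪ {x | T < -v x} := by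
    ext x
    simp [lt_abs]
  rw [hun, two_mul]
  exact (measureReal_union_le _ _).trans
    (add_le_add (h Ω hΩ hΩb v hv hv0 hW I hI hI0 T hT) (hneg T hT))
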